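/- arXiv:1501.05579 — 2 statements merged into one kernel-verified Lean document; each statement's English description precedes it below -/
import Mathlib

section
/- Let G = H ∗_A K be an amalgamated free product with [H : A] ≥ [K : A] ≥ 2, let P be the canonical image of H or the canonical image of K in G, and let η : Σ → G be a finite symmetric generating set of G. Then the set of words over Σ representing an element of P is strongly negligible if and only if [H : A] ≥ 3. -/
universe u

open Monoid

/-- The number of words of length `n` over `α` lying in `L`. -/
noncomputable def wordCount {α : Type*} (L : Set (List α)) (n : ℕ) : ℕ :=
  Nat.card {w : List α // w ∈ L ∧ w.length = n}

/-- A set of words over a finite alphabet is strongly negligible: the number of its words of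
length `n` is at most `C·ρⁿ·|Σ|ⁿ` for some constants `C > 0` and `0 < ρ < 1`. -/
def StronglyNegligible {α : Type*} [Fintype α] (L : Set (List α)) : Prop :=
  ∃ C ρ : ℝ, 0 < C ∧ 0 < ρ ∧ ρ < 1 ∧ ∀ n : ℕ,
    (wordCount L n : ℝ) ≤ C * ρ ^ n * (Fintype.card α : ℝ) ^ n

/-- A set of words is strongly generic if its complement is strongly negligible. -/
def StronglyGeneric {α : Type*} [Fintype α] (L : Set (List α)) : Prop :=
  StronglyNegligible Lᶜ

/-- `η : α → G` together with the involution `inv` is a symmetric generating set: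
`inv` is a fixed-point-free involution, `η (inv a) = (η a)⁻¹`, and the image of `η`
generates `G` as a group. -/
def IsSymmetricGen {α G : Type*} [Group G] (η : α → G) (inv : α → α) : Prop :=
  (∀ a, inv (inv a) = a) ∧ (∀ a, inv a ≠ a) ∧ (∀ a, η (inv a) = (η a)⁻¹) ∧
    Subgroup.closure (Set.range η) = ⊤

/-- The element of `G` represented by a word over `α`. -/
def evalWord {α G : Type*} [Monoid G] (η : α → G) (w : List α) : G :=
  (w.map η).prod

/-- The two-element family of groups used to realize `H ∗_A K` as a pushout. -/
def AmalgFam (H K : Type u) : Bool → Type u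
  | true => H
  | false => K

instance amalgFamGroup {H K : Type u} [Group H] [Group K] : (b : Bool) → Group (AmalgFam H K b)
  | true => ‹Group H›
  | false => ‹Group K›

/-- The two inclusions of the amalgamated subgroup `A`. -/
def amalgMaps {A : Type*} [Group A] {H K : Type u} [Group H] [Group K]
    (φ : A →* H) (ψ : A →* K) : (b : Bool) → A →* AmalgFam H K b
  | true => φ
  | false => ψ

/-- The amalgamated free product `H ∗_A K`, i.e. the pushout of the two inclusions of `A`. -/
abbrev AmalgProd {A : Type*} [Group A] {H K : Type u} [Group H] [Group K]
    (φ : A →* H) (ψ : A →* K) : Type _ :=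
  Monoid.PushoutI (amalgMaps φ ψ)

/-- The canonical map `H →* H ∗_A K`. -/
def amalgH {A : Type*} [Group A] {H K : Type u} [Group H] [Group K]
    (φ : A →* H) (ψ : A →* K) : H →* AmalgProd φ ψ :=
  Monoid.PushoutI.of (φ := amalgMaps φ ψ) true

/-- The canonical map `K →* H ∗_A K`. -/
def amalgK {A : Type*} [Group A] {H K : Type u} [Group H] [Group K]
    (φ : A →* H) (ψ : A →* K) : K →* AmalgProd φ ψ :=
  Monoid.PushoutI.of (φ := amalgMaps φ ψ) false


section NF
open Monoid.PushoutI Monoid.PushoutI.NormalWord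
variable {ι : Type*} {G : ι → Type*} {B : Type*} [∀ i, Group (G i)] [Group B]
  {φ : ∀ i, B →* G i} {d : Transversal φ} [DecidableEq ι] [∀ i, DecidableEq (G i)]

theorem nf_fst_smul {i : ι} (g : G i) (w : NormalWord d) (hmw : w.fstIdx ≠ some i)
    (hgr : g ∉ (φ i).range) : (of (φ := φ) i g • w).fstIdx = some i := by
  rw [← cons_eq_smul g w hmw hgr]
  simp [NormalWord.cons, CoprodI.Word.cons, CoprodI.Word.fstIdx]

theorem nf_fst_base (b : B) (w : NormalWord d) : (base φ b • w).fstIdx = w.fstIdx := by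
  rw [base_smul_def]

theorem nf_fst_of_empty {j i : ι} (hij : i ≠ j) (p : G j) :
    (of (φ := φ) j p • (NormalWord.empty : NormalWord d)).fstIdx ≠ some i := by
  by_cases hp : p ∈ (φ j).range
  · obtain ⟨a, rfl⟩ := hp
    rw [of_apply_eq_base, nf_fst_base]
    simp [NormalWord.empty, CoprodI.Word.empty, CoprodI.Word.fstIdx]
  · rw [nf_fst_smul p _ (by simp [NormalWord.empty, CoprodI.Word.empty, CoprodI.Word.fstIdx]) hp]
    simpa using hij.symm

theorem nf_right_inv {i j : ι} (hij : i ≠ j) (hall : ∀ l, l = i ∨ l = j) (p : G j)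
    (w : NormalWord d) :
    ((w.prod * of (φ := φ) j p) • (NormalWord.empty : NormalWord d)).fstIdx = some i ↔
      w.fstIdx = some i := by
  induction w using consRecOn with
  | empty =>
    rw [prod_empty, one_mul]
    refine ⟨fun h => absurd h (nf_fst_of_empty hij p), fun h => ?_⟩
    simp [NormalWord.empty, CoprodI.Word.empty, CoprodI.Word.fstIdx] at h
  | cons l g w hmw hgn hgr hw1 ih =>
    rw [prod_cons, mul_assoc, mul_smul]
    have h1 : (NormalWord.cons g w hmw hgr).fstIdx = some l := by
      rw [cons_eq_smul]; exact nf_fst_smul g w hmw hgr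
    rw [h1]
    rcases hall l with rfl | rfl
    · simp only [iff_true]
      exact nf_fst_smul _ _ (fun h => hmw (ih.1 h)) hgr
    · cases hw : w.fstIdx with
      | none =>
        have : w = NormalWord.empty := by
          apply NormalWord.ext
          · simpa [NormalWord.empty] using hw1
          · simpa [CoprodI.Word.fstIdx, NormalWord.empty, CoprodI.Word.empty] using hw
        subst this
        rw [prod_empty, one_mul, ← mul_smul, ← map_mul]
        refine ⟨fun h => absurd h (nf_fst_of_empty hij _), fun h => ?_⟩
        exact absurd (Option.some.inj h).symm hij
      | some m =>
        rcases hall m with rfl | rfl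
        · rw [nf_fst_smul _ _ (by rw [ih.2 hw]; simpa using hij) hgr]
        · exact absurd hw hmw
  | base h w hw1 ih =>
    rw [prod_smul, mul_assoc, mul_smul, nf_fst_base, nf_fst_base, ih]

end NF

section L2
variable {X : Type*}

abbrev L2X (X : Type*) := lp (fun _ : X => ℝ) 2

theorem l2_memlp_iff (f : X → ℝ) : Memℓp f 2 ↔ Summable fun x => f x ^ 2 := by
  rw [memℓp_gen_iff (by norm_num)]
  simp

theorem l2_hasSum (f : L2X X) : HasSum (fun x => f x ^ 2) (‖f‖ ^ 2) := by
  have := lp.hasSum_norm (p := 2) (by norm_num) f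
  simpa using this

/-- permutation of coordinates -/
noncomputable def l2Perm (e : Equiv.Perm X) : L2X X →ₗᵢ[ℝ] L2X X where
  toFun f := ⟨fun x => f (e x), (l2_memlp_iff _).2
    ((Equiv.summable_iff e (f := fun x => f x ^ 2)).2 (l2_hasSum f).summable)⟩
  map_add' f g := by ext x; rfl
  map_smul' c f := by ext x; rfl
  norm_map' f := by
    refine (sq_eq_sq₀ (norm_nonneg _) (norm_nonneg _)).1 ?_
    refine (l2_hasSum _).unique ?_
    exact (Equiv.hasSum_iff e (f := fun x => f x ^ 2)).2 (l2_hasSum f)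

@[simp] theorem l2Perm_apply (e : Equiv.Perm X) (f : L2X X) (x : X) : l2Perm e f x = f (e x) := rfl

open Classical in
/-- restriction to a set -/
noncomputable def l2Res (S : Set X) : L2X X →ₗ[ℝ] L2X X where
  toFun f := ⟨fun x => if x ∈ S then f x else 0, (l2_memlp_iff _).2
    (by
      refine Summable.of_nonneg_of_le (fun _ => sq_nonneg _) (fun x => ?_) (l2_hasSum f).summable
      split_ifs
      · exact le_rfl
      · simpa using sq_nonneg _)⟩
  map_add' f g := by
    ext x
    change (if x ∈ S then f x + g x else 0) = (if x ∈ S then f x else 0) + (if x ∈ S then g x else 0)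
    split_ifs <;> simp
  map_smul' c f := by
    ext x
    change (if x ∈ S then c * f x else 0) = c * (if x ∈ S then f x else 0)
    split_ifs <;> simp

open Classical in
@[simp] theorem l2Res_apply (S : Set X) (f : L2X X) (x : X) :
  l2Res S f x = if x ∈ S then f x else 0 := rfl

open Classical in
theorem l2Res_hasSum (S : Set X) (f : L2X X) :
    HasSum (fun x => if x ∈ S then f x ^ 2 else 0) (‖l2Res S f‖ ^ 2) := by
  convert! l2_hasSum (l2Res S f) using 2 with x
  simp

theorem l2Res_norm_le (S : Set X) (f : L2X X) : ‖l2Res S f‖ ≤ ‖f‖ := by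
  classical
  refine (sq_le_sq₀ (norm_nonneg _) (norm_nonneg _)).1 ?_
  refine hasSum_le (fun x => ?_) (l2Res_hasSum S f) (l2_hasSum f)
  split_ifs
  · exact le_rfl
  · exact sq_nonneg _

/-- mass of a set -/
noncomputable def mass (f : L2X X) (S : Set X) : ℝ := ‖l2Res S f‖ ^ 2

theorem mass_cover (f : L2X X) (S T : Set X) (h : ∀ x, x ∈ S ∨ x ∈ T) :
    ‖f‖ ^ 2 ≤ mass f S + mass f T := by
  classical
  refine hasSum_le (fun x => ?_) (l2_hasSum f) ((l2Res_hasSum S f).add (l2Res_hasSum T f))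
  have := sq_nonneg (f x)
  rcases h x with h | h <;> simp [h] <;> split_ifs <;> simp [this]

theorem mass_disj (f : L2X X) (S T U : Set X) (h1 : ∀ x ∈ S, x ∉ T) (h2 : ∀ x ∈ S, x ∉ U)
    (h3 : ∀ x ∈ T, x ∉ U) :
    mass f S + mass f T + mass f U ≤ ‖f‖ ^ 2 := by
  classical
  refine hasSum_le (fun x => ?_) (((l2Res_hasSum S f).add (l2Res_hasSum T f)).add
    (l2Res_hasSum U f)) (l2_hasSum f)
  have := sq_nonneg (f x)
  by_cases hS : x ∈ S
  · simp [hS, h1 x hS, h2 x hS]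
  · by_cases hT : x ∈ T
    · simp [hS, hT, h3 x hT]
    · simp [hS, hT]; split_ifs <;> simp [this]

theorem mass_mono (f : L2X X) (S T : Set X) (h : S ⊆ T) : mass f S ≤ mass f T := by
  classical
  refine hasSum_le (fun x => ?_) (l2Res_hasSum S f) (l2Res_hasSum T f)
  have := sq_nonneg (f x)
  by_cases hS : x ∈ S
  · simp [hS, h hS]
  · simp [hS]; split_ifs <;> simp [this]

theorem mass_perm (e : Equiv.Perm X) (f : L2X X) (S : Set X) :
    mass (l2Perm e f) (e ⁻¹' S) = mass f S := by
  classical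
  refine (l2Res_hasSum _ _).unique ?_
  exact (Equiv.hasSum_iff e (f := fun x => if x ∈ S then f x ^ 2 else 0)).2 (l2Res_hasSum S f)

theorem mass_diff (f g : L2X X) (S : Set X) :
    |mass f S - mass g S| ≤ ‖f - g‖ * (‖f‖ + ‖g‖) := by
  unfold mass
  rw [sq_sub_sq, abs_mul, mul_comm]
  have h1 : |‖l2Res S f‖ - ‖l2Res S g‖| ≤ ‖f - g‖ :=
    (abs_norm_sub_norm_le _ _).trans (by rw [← map_sub]; exact l2Res_norm_le _ _)
  have h2 : |‖l2Res S f‖ + ‖l2Res S g‖| ≤ ‖f‖ + ‖g‖ := by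
    rw [abs_of_nonneg (by positivity)]
    exact add_le_add (l2Res_norm_le _ _) (l2Res_norm_le _ _)
  exact mul_le_mul h1 h2 (abs_nonneg _) (norm_nonneg _)

end L2

section Spec
open Filter Topology Pointwise
variable {G X : Type*} [Group G] [MulAction G X]

/-- the permutation representation on `ℓ²(X)` -/
noncomputable def rep (g : G) : L2X X →ₗᵢ[ℝ] L2X X := l2Perm (MulAction.toPerm g⁻¹)

theorem rep_apply (g : G) (f : L2X X) (x : X) : rep g f x = f (g⁻¹ • x) := rfl

theorem rep_inv_rep (g : G) (f : L2X X) : rep g⁻¹ (rep g f) = f := by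
  ext x; simp [rep_apply]

theorem mass_rep (g : G) (f : L2X X) (S : Set X) : mass (rep g f) (g • S) = mass f S := by
  rw [← mass_perm (MulAction.toPerm g⁻¹) f S]
  unfold rep
  congr 1
  ext x
  simp [Set.mem_smul_set_iff_inv_smul_mem]

/-- total mass of a pair of vectors -/
noncomputable def mass2 (v w : L2X X) (S : Set X) : ℝ := mass v S + mass w S

theorem mass_tendsto (v w : ℕ → L2X X) (hv : ∀ n, ‖v n‖ ≤ 1) (hw : ∀ n, ‖w n‖ ≤ 1)
    (h : Tendsto (fun n => ‖v n - w n‖) atTop (𝓝 0)) (S : Set X) :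
    Tendsto (fun n => mass (v n) S - mass (w n) S) atTop (𝓝 0) := by
  refine squeeze_zero_norm (a := fun n => ‖v n - w n‖ * 2) (fun n => ?_) (by simpa using h.mul_const 2)
  rw [Real.norm_eq_abs]
  refine (mass_diff _ _ _).trans ?_
  have := hv n
  have := hw n
  gcongr
  linarith

/-- elements under which the masses are asymptotically invariant -/
def almostInv (G : Type*) {X : Type*} [Group G] [MulAction G X] (v w : ℕ → L2X X) :
    Subgroup G where
  carrier := {g | ∀ S : Set X, Tendsto (fun n => mass2 (v n) (w n) (g • S) - mass2 (v n) (w n) S)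
    atTop (𝓝 0)}
  one_mem' S := by simp
  mul_mem' {a b} ha hb S := by
    have := (ha (b • S)).add (hb S)
    simpa [mul_smul] using this
  inv_mem' {a} ha S := by
    have := (ha (a⁻¹ • S)).neg
    simpa using this

theorem letter_mem (v w : ℕ → L2X X) (hv : ∀ n, ‖v n‖ ≤ 1) (hw : ∀ n, ‖w n‖ ≤ 1) (g : G)
    (h1 : Tendsto (fun n => ‖rep g (v n) - w n‖) atTop (𝓝 0))
    (h2 : Tendsto (fun n => ‖rep g (w n) - v n‖) atTop (𝓝 0)) : g ∈ almostInv G v w := by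
  intro S
  have a1 := mass_tendsto (fun n => rep g (v n)) w (by simpa using hv) hw h1 (g • S)
  have a2 := mass_tendsto (fun n => rep g (w n)) v (by simpa using hw) hv h2 (g • S)
  have := (a1.add a2).neg
  simp only [mass_rep] at this
  simp only [add_zero, neg_zero] at this
  refine this.congr (fun n => ?_)
  unfold mass2
  ring

theorem no_almost_inv (v w : ℕ → L2X X)
    (htop : almostInv G v w = ⊤) (c : ℝ) (hc : 0 < c)
    (hlow : ∀ᶠ n in atTop, c ≤ ‖v n‖ ^ 2 + ‖w n‖ ^ 2)
    (D : Set X) (k h₁ h₂ : G) (hk : ∀ x, x ∉ D → k • x ∈ D)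
    (d1 : ∀ x ∈ D, x ∉ h₁ • D) (d2 : ∀ x ∈ D, x ∉ h₂ • D) (d3 : ∀ x ∈ h₁ • D, x ∉ h₂ • D) :
    False := by
  have inv : ∀ (g : G) (S : Set X), Tendsto (fun n => mass2 (v n) (w n) (g • S)
      - mass2 (v n) (w n) S) atTop (𝓝 0) := fun g S => by
    have : g ∈ almostInv G v w := by rw [htop]; trivial
    exact this S
  have t := (((inv k Dᶜ).const_mul (-3)).add ((inv h₁ D).const_mul (-2))).add
    ((inv h₂ D).const_mul (-2))
  simp only [mul_zero, add_zero] at t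
  obtain ⟨n, hn1, hn2⟩ := (hlow.and (t.eventually (gt_mem_nhds hc))).exists
  have hsub : k • Dᶜ ⊆ D := by
    rintro _ ⟨x, hx, rfl⟩
    exact hk x hx
  have e1 := mass_cover (v n) D Dᶜ (fun x => em _)
  have e2 := mass_cover (w n) D Dᶜ (fun x => em _)
  have e3 := mass_mono (v n) _ _ hsub
  have e4 := mass_mono (w n) _ _ hsub
  have e5 := mass_disj (v n) D (h₁ • D) (h₂ • D) d1 d2 d3
  have e6 := mass_disj (w n) D (h₁ • D) (h₂ • D) d1 d2 d3
  unfold mass2 at hn2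
  linarith

/-- the (unnormalised) Markov operator -/
noncomputable def markov {α : Type*} [Fintype α] (X : Type*) [MulAction G X] (η : α → G) :
    L2X X →L[ℝ] L2X X :=
  ∑ a, (rep (η a)).toContinuousLinearMap

theorem markov_apply {α : Type*} [Fintype α] (η : α → G) (f : L2X X) :
    markov X η f = ∑ a, rep (η a) f := by
  simp [markov]

theorem markov_norm_lt {α : Type*} [Fintype α] [Nonempty α] (η : α → G) (inv : α → α)
    (hsym : IsSymmetricGen η inv)
    (D : Set X) (k h₁ h₂ : G) (hk : ∀ x, x ∉ D → k • x ∈ D)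
    (d1 : ∀ x ∈ D, x ∉ h₁ • D) (d2 : ∀ x ∈ D, x ∉ h₂ • D) (d3 : ∀ x ∈ h₁ • D, x ∉ h₂ • D) :
    ‖markov X η‖ < Fintype.card α := by
  by_contra! hcon
  set N : ℝ := (Fintype.card α : ℝ) with hN
  have hNpos : 0 < N := by rw [hN]; exact_mod_cast Fintype.card_pos
  have hex : ∀ n : ℕ, ∃ x : L2X X, ‖x‖ < 1 ∧ N * (1 - 1 / ((n : ℝ) + 1)) < ‖markov X η x‖ := by
    intro n
    apply ContinuousLinearMap.exists_lt_apply_of_lt_opNorm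
    refine lt_of_lt_of_le ?_ hcon
    have : 0 < 1 / ((n : ℝ) + 1) := by positivity
    nlinarith
  choose v hv1 hv2 using hex
  set w : ℕ → L2X X := fun n => N⁻¹ • markov X η (v n) with hw
  have hNw : ∀ n, ∑ a, rep (η a) (v n) = N • w n := fun n => by
    rw [hw, ← markov_apply]; simp [smul_smul, hNpos.ne']
  have hwlow : ∀ n : ℕ, 1 - 1 / ((n : ℝ) + 1) < ‖w n‖ := fun n => by
    have := hv2 n
    rw [markov_apply, hNw, norm_smul, Real.norm_of_nonneg hNpos.le] at this
    exact lt_of_mul_lt_mul_left this hNpos.le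
  have hwhigh : ∀ n, ‖w n‖ ≤ 1 := fun n => by
    have : ‖N • w n‖ ≤ N * 1 := by
      rw [← hNw]
      refine (norm_sum_le _ _).trans ?_
      simp only [LinearIsometry.norm_map, Finset.sum_const, Finset.card_univ, nsmul_eq_mul]
      exact mul_le_mul_of_nonneg_left (hv1 n).le hNpos.le
    rw [norm_smul, Real.norm_of_nonneg hNpos.le] at this
    exact le_of_mul_le_mul_left this hNpos
  have hvar : ∀ n, ∑ a, ‖rep (η a) (v n) - w n‖ ^ 2 = N * (‖v n‖ ^ 2 - ‖w n‖ ^ 2) := fun n => by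
    simp only [norm_sub_sq_real, LinearIsometry.norm_map]
    rw [Finset.sum_add_distrib, Finset.sum_sub_distrib, ← Finset.mul_sum, ← sum_inner, hNw,
      real_inner_smul_left, real_inner_self_eq_norm_sq]
    simp only [Finset.sum_const, Finset.card_univ, nsmul_eq_mul]
    ring
  have hone : Tendsto (fun n : ℕ => 1 / ((n : ℝ) + 1)) atTop (𝓝 0) :=
    tendsto_one_div_add_atTop_nhds_zero_nat
  have hsq : ∀ a, Tendsto (fun n => ‖rep (η a) (v n) - w n‖ ^ 2) atTop (𝓝 0) := fun a => by
    refine squeeze_zero (g := fun n : ℕ => N * (2 * (1 / ((n : ℝ) + 1)))) (fun _ => sq_nonneg _)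
      (fun n => ?_) (by simpa using (hone.const_mul 2).const_mul N)
    calc ‖rep (η a) (v n) - w n‖ ^ 2 ≤ ∑ a, ‖rep (η a) (v n) - w n‖ ^ 2 :=
          Finset.single_le_sum (f := fun a => ‖rep (η a) (v n) - w n‖ ^ 2)
            (fun _ _ => sq_nonneg _) (Finset.mem_univ a)
      _ = N * (‖v n‖ ^ 2 - ‖w n‖ ^ 2) := hvar n
      _ ≤ _ := by
        apply mul_le_mul_of_nonneg_left _ hNpos.le
        have h1 := hv1 n
        have h2 := hwlow n
        have h3 := norm_nonneg (v n)
        have h4 := hwhigh n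
        nlinarith [norm_nonneg (w n)]
  have hA : ∀ a, Tendsto (fun n => ‖rep (η a) (v n) - w n‖) atTop (𝓝 0) := fun a => by
    have := (hsq a).sqrt
    simpa using this
  have hB : ∀ a, Tendsto (fun n => ‖rep (η a) (w n) - v n‖) atTop (𝓝 0) := fun a => by
    refine (hA (inv a)).congr (fun n => ?_)
    rw [hsym.2.2.1 a, ← LinearIsometry.norm_map (rep (X := X) (η a)⁻¹) (rep (η a) (w n) - v n),
      map_sub, rep_inv_rep, norm_sub_rev]
  have htop : almostInv G v w = ⊤ := by
    rw [eq_top_iff, ← hsym.2.2.2, Subgroup.closure_le]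
    rintro _ ⟨a, rfl⟩
    exact letter_mem v w (fun n => (hv1 n).le) hwhigh _ (hA a) (hB a)
  refine no_almost_inv v w htop (1/4) (by norm_num) ?_ D k h₁ h₂ hk d1 d2 d3
  filter_upwards [eventually_ge_atTop 1] with n hn
  have h1 : (1 : ℝ) / ((n : ℝ) + 1) ≤ 1 / 2 := by
    apply one_div_le_one_div_of_le (by norm_num)
    have : (1 : ℝ) ≤ n := by exact_mod_cast hn
    linarith
  have h2 := hwlow n
  nlinarith [sq_nonneg ‖v n‖]

instance wordFinite {α : Type*} [Fintype α] (L : Set (List α)) (n : ℕ) :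
    Finite {w : List α // w ∈ L ∧ w.length = n} :=
  Set.Finite.subset (List.finite_length_eq α n) (fun _ h => h.2)

theorem wordCount_succ {α : Type*} [Fintype α] (L : Set (List α)) (n : ℕ) :
    wordCount L (n + 1) = ∑ a, wordCount {w | a :: w ∈ L} n := by
  unfold wordCount
  rw [← Nat.card_sigma]
  refine Nat.card_congr ⟨fun w => ?_, fun p => ⟨p.1 :: p.2.1, p.2.2.1, by simp [p.2.2.2]⟩, ?_, ?_⟩
  · obtain ⟨w, h1, h2⟩ := w
    cases w with
    | nil => simp at h2
    | cons a w => exact ⟨a, w, h1, by simpa using h2⟩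
  · rintro ⟨w, h1, h2⟩
    cases w with
    | nil => simp at h2
    | cons a w => rfl
  · rintro ⟨a, w, h1, h2⟩
    rfl

open Classical in
theorem markov_pow_apply {α : Type*} [Fintype α] (η : α → G) (o : X) (n : ℕ) (x : X) :
    ((markov X η)^[n] (lp.single 2 o (1 : ℝ))) x
      = wordCount {w : List α | evalWord η w • o = x} n := by
  induction n generalizing x with
  | zero =>
    unfold wordCount
    by_cases h : o = x
    · subst h
      have : Nat.card {w : List α // w ∈ {w : List α | evalWord η w • o = o} ∧ w.length = 0} = 1 := by
        rw [Nat.card_eq_one_iff_exists]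
        refine ⟨⟨[], by simp [evalWord]⟩, ?_⟩
        rintro ⟨w, h1, h2⟩
        simpa using h2
      rw [this]
      simp
    · have : Nat.card {w : List α // w ∈ {w : List α | evalWord η w • o = x} ∧ w.length = 0} = 0 := by
        rw [Nat.card_eq_zero]
        left
        constructor
        rintro ⟨w, h1, h2⟩
        rw [List.length_eq_zero_iff] at h2
        subst h2
        exact h (by simpa [evalWord] using h1)
      rw [this]
      simp [Ne.symm h]
  | succ n ih =>
    rw [Function.iterate_succ_apply', markov_apply, wordCount_succ, lp.coeFn_sum, Finset.sum_apply]
    push_cast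
    refine Finset.sum_congr rfl (fun a _ => ?_)
    rw [rep_apply, ih]
    congr 2
    ext w
    simp [evalWord, mul_smul, eq_inv_smul_iff]

theorem negligible_of_paradox {α : Type*} [Fintype α] [Nonempty α] (η : α → G) (inv : α → α)
    (hsym : IsSymmetricGen η inv) (o : X)
    (D : Set X) (k h₁ h₂ : G) (hk : ∀ x, x ∉ D → k • x ∈ D)
    (d1 : ∀ x ∈ D, x ∉ h₁ • D) (d2 : ∀ x ∈ D, x ∉ h₂ • D) (d3 : ∀ x ∈ h₁ • D, x ∉ h₂ • D) :
    StronglyNegligible {w : List α | evalWord η w • o = o} := by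
  classical
  have hlt := markov_norm_lt η inv hsym D k h₁ h₂ hk d1 d2 d3
  set N : ℝ := (Fintype.card α : ℝ) with hN
  have hNpos : 0 < N := by rw [hN]; exact_mod_cast Fintype.card_pos
  refine ⟨1, max (‖markov X η‖ / N) (1/2), one_pos, by positivity, ?_, fun n => ?_⟩
  · rw [max_lt_iff, div_lt_one hNpos]
    exact ⟨hlt, by norm_num⟩
  · rw [one_mul, ← mul_pow, ← markov_pow_apply]
    have h1 : ∀ n, ‖(markov X η)^[n] (lp.single 2 o (1 : ℝ))‖ ≤ ‖markov X η‖ ^ n := by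
      intro n
      induction n with
      | zero => simp [lp.norm_single]
      | succ n ih =>
        rw [Function.iterate_succ_apply', pow_succ']
        exact (ContinuousLinearMap.le_opNorm _ _).trans
          (mul_le_mul_of_nonneg_left ih (norm_nonneg _))
    have h2 := lp.norm_apply_le_norm (p := 2) (by norm_num)
      ((markov X η)^[n] (lp.single 2 o (1 : ℝ))) o
    refine ((le_abs_self _).trans h2).trans ((h1 n).trans ?_)
    apply pow_le_pow_left₀ (norm_nonneg _)
    rw [← div_le_iff₀ hNpos]
    exact le_max_left _ _

end Spec

section Growth
open Filter Topology

theorem dih_conj {Q : Type*} [Group Q] {x y : Q} (hx : x * x = 1) (hy : y * y = 1) (i : ℤ) :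
    x * (x * y) ^ i = (x * y) ^ (-i) * x := by
  have hxi : x⁻¹ = x := inv_eq_of_mul_eq_one_left hx
  have hyi : y⁻¹ = y := inv_eq_of_mul_eq_one_left hy
  have h : (x * y)⁻¹ = x * (x * y) * x⁻¹ := by
    rw [mul_inv_rev, hxi, hyi, ← mul_assoc x x y, hx, one_mul]
  rw [zpow_neg, ← inv_zpow, h, conj_zpow]
  group

/-- elements at bounded distance in a dihedral-like group -/
def dball {Q : Type*} [Group Q] (x y : Q) (m : ℕ) : Set Q :=
  {q | ∃ i : ℤ, -m ≤ i ∧ i ≤ m ∧ (q = (x * y) ^ i ∨ q = (x * y) ^ i * x)}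

theorem dball_mono {Q : Type*} [Group Q] {x y : Q} {m n : ℕ} (h : m ≤ n) :
    dball x y m ⊆ dball x y n := by
  rintro q ⟨i, h1, h2, h3⟩
  exact ⟨i, by lia, by lia, h3⟩

theorem dball_mul {Q : Type*} [Group Q] {x y : Q} (hx : x * x = 1) (hy : y * y = 1) {m n : ℕ}
    {p q : Q} (hp : p ∈ dball x y m) (hq : q ∈ dball x y n) : p * q ∈ dball x y (m + n) := by
  obtain ⟨i, i1, i2, i3⟩ := hp
  obtain ⟨j, j1, j2, j3⟩ := hq
  rcases i3 with rfl | rfl <;> rcases j3 with rfl | rfl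
  · exact ⟨i + j, by lia, by lia, Or.inl (zpow_add _ _ _).symm⟩
  · exact ⟨i + j, by lia, by lia, Or.inr (by rw [zpow_add, mul_assoc])⟩
  · exact ⟨i - j, by lia, by lia, Or.inr (by
      rw [mul_assoc, dih_conj hx hy, sub_eq_add_neg, zpow_add, mul_assoc])⟩
  · exact ⟨i - j, by lia, by lia, Or.inl (by
      rw [mul_assoc, ← mul_assoc x, dih_conj hx hy, mul_assoc _ x x, hx, mul_one,
        sub_eq_add_neg, zpow_add])⟩

theorem dball_all {Q : Type*} [Group Q] {x y : Q} (hx : x * x = 1) (hy : y * y = 1)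
    (hgen : Subgroup.closure {x, y} = ⊤) (q : Q) : ∃ m, q ∈ dball x y m := by
  have hq : q ∈ Subgroup.closure {x, y} := by rw [hgen]; trivial
  induction hq using Subgroup.closure_induction with
  | mem q hq =>
    rcases hq with rfl | rfl
    · exact ⟨0, 0, by simp⟩
    · refine ⟨1, -1, by simp, by simp, Or.inr ?_⟩
      rw [← dih_conj hx hy, zpow_one, ← mul_assoc, hx, one_mul]
  | one => exact ⟨0, 0, by simp⟩
  | mul p q _ _ hp hq =>
    obtain ⟨m, hm⟩ := hp
    obtain ⟨n, hn⟩ := hq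
    exact ⟨m + n, dball_mul hx hy hm hn⟩
  | inv q _ hq =>
    obtain ⟨m, i, h1, h2, h3⟩ := hq
    rcases h3 with rfl | rfl
    · exact ⟨m, -i, by lia, by lia, Or.inl (zpow_neg _ _).symm⟩
    · refine ⟨m, i, h1, h2, Or.inr ?_⟩
      rw [mul_inv_rev, ← zpow_neg, inv_eq_of_mul_eq_one_left hx, dih_conj hx hy, neg_neg]

open Classical in
theorem dball_finset {Q : Type*} [Group Q] (x y : Q) (m : ℕ) :
    ∃ B : Finset Q, B.card ≤ 4 * m + 2 ∧ B.Nonempty ∧ dball x y m ⊆ B := by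
  refine ⟨(Finset.Icc (-m : ℤ) m).image (fun i => (x * y) ^ i) ∪
    (Finset.Icc (-m : ℤ) m).image (fun i => (x * y) ^ i * x), ?_, ?_, ?_⟩
  · refine (Finset.card_union_le _ _).trans ?_
    have h1 := Finset.card_image_le (s := Finset.Icc (-m : ℤ) m) (f := fun i => (x * y) ^ i)
    have h2 := Finset.card_image_le (s := Finset.Icc (-m : ℤ) m) (f := fun i => (x * y) ^ i * x)
    have h3 : (Finset.Icc (-m : ℤ) m).card = 2 * m + 1 := by simp; lia
    lia
  · exact ⟨1, by simp only [Finset.mem_union, Finset.mem_image]; left; exact ⟨0, by simp⟩⟩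
  · rintro q ⟨i, h1, h2, h3⟩
    simp only [Finset.coe_union, Finset.coe_image, Set.mem_union, Set.mem_image, Finset.coe_Icc,
      Set.mem_Icc]
    rcases h3 with rfl | rfl
    · exact Or.inl ⟨i, ⟨h1, h2⟩, rfl⟩
    · exact Or.inr ⟨i, ⟨h1, h2⟩, rfl⟩

theorem evalWord_dball {Q : Type*} [Group Q] {x y : Q} (hx : x * x = 1) (hy : y * y = 1)
    {α : Type*} (η : α → Q) (M : ℕ) (hM : ∀ a, η a ∈ dball x y M) (w : List α) :
    evalWord η w ∈ dball x y (w.length * M) := by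
  induction w with
  | nil => exact ⟨0, by simp [evalWord]⟩
  | cons a w ih =>
    have := dball_mul hx hy (hM a) ih
    have e : (a :: w).length * M = M + w.length * M := by rw [List.length_cons]; ring
    rw [e]
    simpa [evalWord] using this

theorem evalWord_inv {Q : Type*} [Group Q] {α : Type*} (η : α → Q) (inv : α → α)
    (h : ∀ a, η (inv a) = (η a)⁻¹) (w : List α) :
    evalWord η (w.map inv).reverse = (evalWord η w)⁻¹ := by
  induction w with
  | nil => simp [evalWord]
  | cons a w ih =>
    simp only [evalWord] at ih ⊢
    simp [h] at ih ⊢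
    simpa [Function.comp_def, h] using ih

theorem wordCount_lower {Q : Type*} [Group Q] {α : Type*} [Fintype α] (η : α → Q) (inv : α → α)
    (h1 : ∀ a, inv (inv a) = a) (h2 : ∀ a, η (inv a) = (η a)⁻¹) (n : ℕ) (B : Finset Q)
    (hB : B.Nonempty) (hev : ∀ w : List α, w.length = n → evalWord η w ∈ B) :
    Fintype.card α ^ (2 * n) ≤ 4 * B.card ^ 2 * (wordCount {w : List α | evalWord η w = 1} (2 * n) + 1) := by
  classical
  have hinj : Function.Injective inv := fun a b h => by rw [← h1 a, h, h1]
  set N := Fintype.card α ^ n with hN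
  obtain ⟨q, hq, hc⟩ := Finset.exists_le_card_fiber_of_mul_le_card_of_maps_to
    (s := (Finset.univ : Finset (List.Vector α n))) (t := B) (f := fun w => evalWord η w.1)
    (n := N / B.card) (fun w _ => hev w.1 w.2) hB (by
      rw [Finset.card_univ, card_vector]; exact Nat.mul_div_le _ _)
  set F := {w ∈ (Finset.univ : Finset (List.Vector α n)) | evalWord η w.1 = q} with hF
  have hle : F.card * F.card ≤ wordCount {w : List α | evalWord η w = 1} (2 * n) := by
    unfold wordCount
    rw [← Finset.card_product, ← Nat.card_eq_finsetCard]
    refine Nat.card_le_card_of_injective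
      (fun p : {p // p ∈ F ×ˢ F} => (⟨(p.1.1.1.map inv).reverse ++ p.1.2.1, ?_, ?_⟩ :
        {w : List α // w ∈ {w : List α | evalWord η w = 1} ∧ w.length = 2 * n})) ?_
    · have hp := p.2
      simp only [hF, Finset.mem_product, Finset.mem_filter, Finset.mem_univ, true_and] at hp
      have := evalWord_inv η inv h2 p.1.1.1
      simp only [evalWord] at this hp
      simp only [evalWord, Set.mem_ofPred_eq, List.map_append, List.prod_append, this, hp.1, hp.2,
        inv_mul_cancel]
    · simp [p.1.1.2, p.1.2.2]; ring
    · rintro ⟨⟨⟨u, hu⟩, ⟨v, hv⟩⟩, hp⟩ ⟨⟨⟨u', hu'⟩, ⟨v', hv'⟩⟩, hp'⟩ h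
      simp only [Subtype.mk.injEq] at h
      have := List.append_inj h (by simp [hu, hu'])
      have e1 := (List.map_injective_iff.2 hinj) (List.reverse_injective this.1)
      have e2 := this.2
      subst e1 e2
      rfl
  have hBpos : 0 < B.card := hB.card_pos
  have h3 : N < B.card * (F.card + 1) := by
    have := Nat.lt_mul_div_succ N hBpos
    refine this.trans_le ?_
    gcongr
  have h4 : N ^ 2 ≤ (B.card * (F.card + 1)) ^ 2 := by gcongr
  have h5 : Fintype.card α ^ (2 * n) = N ^ 2 := by rw [hN, ← pow_mul, mul_comm]
  rw [h5]
  refine h4.trans ?_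
  rw [mul_pow]
  have h6 : (F.card + 1) ^ 2 ≤ 4 * (F.card * F.card + 1) := by
    zify
    nlinarith [sq_nonneg ((F.card : ℤ) - 1)]
  calc B.card ^ 2 * (F.card + 1) ^ 2 ≤ B.card ^ 2 * (4 * (F.card * F.card + 1)) := by gcongr
    _ ≤ B.card ^ 2 * (4 * (wordCount {w : List α | evalWord η w = 1} (2 * n) + 1)) := by gcongr
    _ = _ := by ring

end Growth

section Growth2
open Filter Topology

theorem not_negligible_dih {Q : Type*} [Group Q] {x y : Q} (hx : x * x = 1) (hy : y * y = 1)
    (hgen : Subgroup.closure {x, y} = ⊤) {α : Type*} [Fintype α] [Nonempty α] (η : α → Q)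
    (inv : α → α) (h1 : ∀ a, inv (inv a) = a) (h0 : ∀ a, inv a ≠ a)
    (h2 : ∀ a, η (inv a) = (η a)⁻¹) :
    ¬ StronglyNegligible {w : List α | evalWord η w = 1} := by
  rintro ⟨C, ρ, hC, hρ, hρ1, hb⟩
  have hMex : ∃ M, ∀ a, η a ∈ dball x y M := by
    choose m hm using fun a => dball_all hx hy hgen (η a)
    exact ⟨Finset.univ.sup m, fun a => dball_mono (Finset.le_sup (Finset.mem_univ a)) (hm a)⟩
  obtain ⟨M, hM⟩ := hMex
  have hcard : (2 : ℝ) ≤ (Fintype.card α : ℝ) := by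
    obtain ⟨a⟩ := ‹Nonempty α›
    exact_mod_cast Fintype.one_lt_card_iff.2 ⟨_, _, h0 a⟩
  set N : ℝ := (Fintype.card α : ℝ) with hN
  have hNpos : 0 < N := by linarith
  have key : ∀ n : ℕ, (1 : ℝ) ≤
      4 * (4 * (n * M) + 2) ^ 2 * (C * (ρ ^ 2) ^ n + (1 / 4) ^ n) := by
    intro n
    obtain ⟨B, hB1, hB2, hB3⟩ := dball_finset x y (n * M)
    have hlow := wordCount_lower η inv h1 h2 n B hB2 (fun w hw => by
      have := evalWord_dball hx hy η M hM w
      rw [hw] at this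
      exact hB3 this)
    have hlow' : N ^ (2 * n) ≤
        4 * (B.card : ℝ) ^ 2 * (wordCount {w : List α | evalWord η w = 1} (2 * n) + 1) := by
      rw [hN]; exact_mod_cast hlow
    have hB1' : (B.card : ℝ) ≤ 4 * (n * M) + 2 := by exact_mod_cast hB1
    have hP : (0 : ℝ) < N ^ (2 * n) := by positivity
    have h5 : (1 : ℝ) ≤ (1 / 4) ^ n * N ^ (2 * n) := by
      rw [pow_mul, ← mul_pow]
      apply one_le_pow₀
      nlinarith
    have h6 : (wordCount {w : List α | evalWord η w = 1} (2 * n) + 1 : ℝ) ≤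
        (C * (ρ ^ 2) ^ n + (1 / 4) ^ n) * N ^ (2 * n) := by
      have := hb (2 * n)
      rw [pow_mul ρ] at this
      rw [add_mul]
      linarith
    have h7 : N ^ (2 * n) ≤ 4 * (4 * (n * M) + 2) ^ 2 *
        ((C * (ρ ^ 2) ^ n + (1 / 4) ^ n) * N ^ (2 * n)) := by
      refine hlow'.trans ?_
      gcongr
    have h8 : 1 * N ^ (2 * n) ≤ (4 * (4 * (n * M) + 2) ^ 2 *
        (C * (ρ ^ 2) ^ n + (1 / 4) ^ n)) * N ^ (2 * n) := by
      rw [one_mul]; linarith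
    exact le_of_mul_le_mul_right h8 hP
  have hr : |ρ ^ 2| < 1 := by
    rw [abs_of_pos (by positivity)]
    exact pow_lt_one₀ hρ.le hρ1 two_ne_zero
  have T : ∀ r : ℝ, |r| < 1 →
      Tendsto (fun n : ℕ => 4 * (4 * ((n : ℝ) * M) + 2) ^ 2 * r ^ n) atTop (𝓝 0) := by
    intro r hr
    have t2 := (tendsto_pow_const_mul_const_pow_of_abs_lt_one 2 hr).const_mul (64 * (M : ℝ) ^ 2)
    have t1 := (tendsto_pow_const_mul_const_pow_of_abs_lt_one 1 hr).const_mul (64 * (M : ℝ))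
    have t0 := (tendsto_pow_const_mul_const_pow_of_abs_lt_one 0 hr).const_mul (16 : ℝ)
    have := (t2.add t1).add t0
    simp only [mul_zero, add_zero] at this
    refine this.congr (fun n => ?_)
    ring
  have := ((T _ hr).const_mul C).add (T (1/4) (by rw [abs_of_pos] <;> norm_num))
  simp only [mul_zero, add_zero] at this
  obtain ⟨n, hn⟩ := (this.eventually (gt_mem_nhds one_pos)).exists
  have := key n
  nlinarith

theorem negligible_mono {α : Type*} [Fintype α] {L L' : Set (List α)} (h : L ⊆ L')
    (hL : StronglyNegligible L') : StronglyNegligible L := by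
  obtain ⟨C, ρ, h1, h2, h3, h4⟩ := hL
  refine ⟨C, ρ, h1, h2, h3, fun n => le_trans ?_ (h4 n)⟩
  have : Finite {w : List α // w ∈ L' ∧ w.length = n} :=
    Set.Finite.subset (List.finite_length_eq α n) (fun _ h => h.2)
  unfold wordCount
  exact_mod_cast Nat.card_le_card_of_injective
    (fun w : {w : List α // w ∈ L ∧ w.length = n} =>
      (⟨w.1, h w.2.1, w.2.2⟩ : {w : List α // w ∈ L' ∧ w.length = n}))
    (fun a b hab => Subtype.ext (by simpa using hab))

end Growth2

section Final
open Pointwise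

theorem negligible_of_set {G : Type*} [Group G] (P : Subgroup G) (S : Set G)
    (hS : ∀ g, ∀ p ∈ P, g * p ∈ S ↔ g ∈ S) {α : Type*} [Fintype α] [Nonempty α] (η : α → G)
    (inv : α → α) (hsym : IsSymmetricGen η inv) (k h₁ h₂ : G)
    (hk : ∀ g, g ∉ S → k * g ∈ S) (e1 : ∀ g ∈ S, h₁ * g ∉ S) (e2 : ∀ g ∈ S, h₂ * g ∉ S)
    (e3 : ∀ g ∈ S, h₁⁻¹ * h₂ * g ∉ S) :
    StronglyNegligible {w : List α | evalWord η w ∈ P} := by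
  set D : Set (G ⧸ P) := QuotientGroup.mk '' S with hD
  have hmem : ∀ g : G, (QuotientGroup.mk g : G ⧸ P) ∈ D ↔ g ∈ S := by
    intro g
    constructor
    · rintro ⟨g', h1, h2⟩
      rw [QuotientGroup.eq] at h2
      have := (hS g' _ h2).2 h1
      simpa using this
    · exact fun h => ⟨g, h, rfl⟩
  have hsm : ∀ (g g' : G), g • (QuotientGroup.mk g' : G ⧸ P) = QuotientGroup.mk (g * g') :=
    fun _ _ => rfl
  have main := negligible_of_paradox (X := G ⧸ P) η inv hsym (QuotientGroup.mk 1) D k h₁ h₂ ?_ ?_ ?_ ?_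
  · refine negligible_mono ?_ main
    intro w hw
    simp only [Set.mem_ofPred_eq, hsm, mul_one] at hw ⊢
    rw [QuotientGroup.eq]
    simpa using hw
  · intro x
    induction x using QuotientGroup.induction_on with | H g => ?_
    rw [hsm, hmem, hmem]
    exact hk g
  · intro x
    induction x using QuotientGroup.induction_on with | H g => ?_
    rw [Set.mem_smul_set_iff_inv_smul_mem, hsm, hmem, hmem]
    intro h h'
    exact e1 _ h' (by simpa using h)
  · intro x
    induction x using QuotientGroup.induction_on with | H g => ?_
    rw [Set.mem_smul_set_iff_inv_smul_mem, hsm, hmem, hmem]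
    intro h h'
    exact e2 _ h' (by simpa using h)
  · intro x
    induction x using QuotientGroup.induction_on with | H g => ?_
    rw [Set.mem_smul_set_iff_inv_smul_mem, Set.mem_smul_set_iff_inv_smul_mem, hsm, hsm, hmem, hmem]
    intro h h'
    exact e3 _ h' (by simpa [mul_assoc] using h)

theorem card_eq_two {c : Cardinal} (h2 : 2 ≤ c) (h3 : ¬ 3 ≤ c) : Cardinal.toNat c = 2 := by
  have h3 := not_le.1 h3
  obtain ⟨n, rfl⟩ := Cardinal.lt_aleph0.1 (h3.trans (Cardinal.natCast_lt_aleph0 (n := 3)))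
  rw [Cardinal.toNat_natCast]
  have a : 2 ≤ n := by exact_mod_cast h2
  have b : n < 3 := by exact_mod_cast h3
  lia

theorem exists_notMem_range {A H : Type*} [Group A] [Group H] (φ : A →* H)
    (h : 2 ≤ Cardinal.mk (H ⧸ φ.range)) : ∃ x, x ∉ φ.range := by
  obtain ⟨q, hq⟩ := (Cardinal.two_le_iff' (QuotientGroup.mk 1 : H ⧸ φ.range)).1 h
  induction q using QuotientGroup.induction_on with | H g => ?_
  refine ⟨g, fun hg => hq (Eq.symm ?_)⟩
  rw [QuotientGroup.eq]
  simpa using hg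

theorem exists_two_notMem_range {A H : Type*} [Group A] [Group H] (φ : A →* H)
    (h : 3 ≤ Cardinal.mk (H ⧸ φ.range)) :
    ∃ x y, x ∉ φ.range ∧ y ∉ φ.range ∧ x⁻¹ * y ∉ φ.range := by
  obtain ⟨x, hx⟩ := exists_notMem_range φ (le_trans (by norm_num) h)
  obtain ⟨q, hq1, hq2⟩ := Cardinal.exists_ne_ne_of_three_le h (QuotientGroup.mk 1 : H ⧸ φ.range)
    (QuotientGroup.mk x)
  induction q using QuotientGroup.induction_on with | H g => ?_
  refine ⟨x, g, hx, fun hg => hq1 (Eq.symm ?_), fun hg => hq2 (Eq.symm ?_)⟩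
  · rw [QuotientGroup.eq]
    simpa using hg
  · rw [QuotientGroup.eq]
    exact hg

open Monoid.PushoutI Monoid.PushoutI.NormalWord in
theorem negligible_amalg {G : Bool → Type*} {B : Type*} [∀ i, Group (G i)] [Group B]
    (φ : ∀ i, B →* G i) (hφ : ∀ i, Function.Injective (φ i))
    (k : G false) (hk : k ∉ (φ false).range) (h₁ h₂ : G true) (hh₁ : h₁ ∉ (φ true).range)
    (hh₂ : h₂ ∉ (φ true).range) (hh₃ : h₁⁻¹ * h₂ ∉ (φ true).range) (b : Bool)
    {α : Type*} [Fintype α] [Nonempty α] (η : α → Monoid.PushoutI φ)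
    (inv : α → α) (hsym : IsSymmetricGen η inv) :
    StronglyNegligible {w : List α | evalWord η w ∈ (of (φ := φ) b).range} := by
  classical
  obtain ⟨d⟩ := transversal_nonempty φ hφ
  let F : Monoid.PushoutI φ → Option Bool := fun g => (g • (NormalWord.empty : NormalWord d)).fstIdx
  have hF : ∀ (i : Bool) (x : G i), x ∉ (φ i).range → ∀ g, F g ≠ some i →
      F (of i x * g) = some i := by
    intro i x hx g hg
    simp only [F, mul_smul]
    exact nf_fst_smul x _ hg hx
  have hR : ∀ (i j : Bool), i ≠ j → ∀ (p : G j) g, F (g * of j p) = some i ↔ F g = some i := by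
    intro i j hij p g
    have := nf_right_inv (φ := φ) (d := d) hij
      (by intro l; cases i <;> cases j <;> cases l <;> simp_all) p
      (g • (NormalWord.empty : NormalWord d))
    rw [prod_smul, prod_empty, mul_one] at this
    exact this
  cases b with
  | true =>
    refine negligible_of_set _ {g | F g = some false} ?_ η inv hsym (of false k) (of true h₁)
      (of true h₂) ?_ ?_ ?_ ?_
    · rintro g _ ⟨p, rfl⟩
      exact hR false true (by simp) p g
    · intro g hg
      exact hF _ _ hk _ hg
    · intro g (hg : F g = some false)
      simp [hF _ _ hh₁ g (by simp [hg])]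
    · intro g (hg : F g = some false)
      simp [hF _ _ hh₂ g (by simp [hg])]
    · intro g (hg : F g = some false)
      rw [← map_inv, ← map_mul]
      have := hF _ _ hh₃ g (by simp [hg])
      rw [Set.mem_ofPred_eq, this]
      simp
  | false =>
    refine negligible_of_set _ {g | F g ≠ some true} ?_ η inv hsym (of false k) (of true h₁)
      (of true h₂) ?_ ?_ ?_ ?_
    · rintro g _ ⟨p, rfl⟩
      exact not_congr (hR true false (by simp) p g)
    · intro g hg
      have hg : F g = some true := by simpa using hg
      simp [hF _ _ hk g (by simp [hg])]
    · intro g (hg : F g ≠ some true)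
      simp [hF _ _ hh₁ g hg]
    · intro g (hg : F g ≠ some true)
      simp [hF _ _ hh₂ g hg]
    · intro g (hg : F g ≠ some true)
      rw [← map_inv, ← map_mul]
      have := hF _ _ hh₃ g hg
      rw [Set.mem_ofPred_eq, this]
      simp

open Monoid.PushoutI in
theorem not_negligible_amalg {G : Bool → Type*} {B : Type*} [∀ i, Group (G i)] [Group B]
    (φ : ∀ i, B →* G i) (hidx : ∀ i, (φ i).range.index = 2)
    (P : Subgroup (Monoid.PushoutI φ)) (hP : (base φ).range ≤ P)
    {α : Type*} [Fintype α] [Nonempty α] (η : α → Monoid.PushoutI φ)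
    (inv : α → α) (hsym : IsSymmetricGen η inv) :
    ¬ StronglyNegligible {w : List α | evalWord η w ∈ P} := by
  have hnorm : (base φ).range.Normal := by
    constructor
    rintro n hn g
    induction g using Monoid.PushoutI.induction_on generalizing n with
    | of i g =>
      obtain ⟨b, rfl⟩ := hn
      have := (Subgroup.normal_of_index_eq_two (hidx i)).conj_mem (φ i b) ⟨b, rfl⟩ g
      obtain ⟨c, hc⟩ := this
      refine ⟨c, ?_⟩
      rw [← of_apply_eq_base φ i, ← of_apply_eq_base φ i, hc]
      simp
    | base h => exact mul_mem (mul_mem ⟨h, rfl⟩ hn) (inv_mem ⟨h, rfl⟩)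
    | mul x y hx hy =>
      have := hx _ (hy _ hn)
      simpa [mul_assoc] using this
  let π := QuotientGroup.mk' (base φ).range
  have hπ : ∀ i (g : G i), g ∈ (φ i).range → π (of i g) = 1 := by
    rintro i _ ⟨b, rfl⟩
    rw [of_apply_eq_base]
    exact (QuotientGroup.eq_one_iff _).2 ⟨b, rfl⟩
  have hex : ∀ i, ∃ x : G i, x ∉ (φ i).range := by
    intro i
    by_contra! h
    have : (φ i).range = ⊤ := eq_top_iff.2 fun x _ => h x
    have h2 := hidx i
    rw [this] at h2
    simp at h2
  choose t ht using hex
  have hsq : ∀ i, π (of i (t i)) * π (of i (t i)) = 1 := fun i => by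
    rw [← map_mul, ← map_mul]
    exact hπ _ _ ((Subgroup.mul_mem_iff_of_index_two (hidx i)).2 Iff.rfl)
  have hgen : Subgroup.closure {π (of true (t true)), π (of false (t false))} = ⊤ := by
    set C := Subgroup.closure {π (of true (t true)), π (of false (t false))} with hC
    have ht' : ∀ i, π (of i (t i)) ∈ C := by
      intro i
      apply Subgroup.subset_closure
      cases i <;> simp
    rw [eq_top_iff]
    intro q _
    obtain ⟨g, rfl⟩ := QuotientGroup.mk'_surjective _ q
    change π g ∈ C
    induction g using Monoid.PushoutI.induction_on with
    | of i g =>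
      by_cases hg : g ∈ (φ i).range
      · rw [hπ i g hg]; exact one_mem _
      · have h1 : (t i)⁻¹ * g ∈ (φ i).range := by
          rw [Subgroup.mul_mem_iff_of_index_two (hidx i), inv_mem_iff]
          exact iff_of_false (ht i) hg
        have h2 := hπ i _ h1
        rw [map_mul, map_mul, map_inv, map_inv, inv_mul_eq_one] at h2
        rw [← h2]
        exact ht' i
    | base h =>
      rw [← of_apply_eq_base φ true, hπ _ _ ⟨h, rfl⟩]; exact one_mem _
    | mul x y hx hy => rw [map_mul]; exact mul_mem (hx trivial) (hy trivial)
  have main := not_negligible_dih (hsq true) (hsq false) hgen (fun a => π (η a)) inv hsym.1 hsym.2.1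
    (fun a => by rw [hsym.2.2.1, map_inv])
  refine fun h => main (negligible_mono ?_ h)
  intro w hw
  apply hP
  have : π (evalWord η w) = 1 := by
    simp only [Set.mem_ofPred_eq, evalWord] at hw ⊢
    rw [map_list_prod, List.map_map]
    exact hw
  exact (QuotientGroup.eq_one_iff _).1 this

end Final

/-- For `G = H ∗_A K` with `[H:A] ≥ [K:A] ≥ 2`, `P` the canonical image
of `H` or of `K`, and `η : Σ → G` a finite symmetric generating set, the set of words over
`Σ` representing an element of `P` is strongly negligible iff `[H:A] ≥ 3`. -/
theorem stmt_0 {A : Type*} {H K : Type u} [Group A] [Group H] [Group K]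
    (φ : A →* H) (ψ : A →* K) (hφ : Function.Injective φ) (hψ : Function.Injective ψ)
    (hHK : Cardinal.mk (K ⧸ ψ.range) ≤ Cardinal.mk (H ⧸ φ.range))
    (hK2 : 2 ≤ Cardinal.mk (K ⧸ ψ.range))
    (P : Subgroup (AmalgProd φ ψ))
    (hP : P = (amalgH φ ψ).range ∨ P = (amalgK φ ψ).range)
    {α : Type*} [Fintype α] (η : α → AmalgProd φ ψ) (inv : α → α)
    (hsym : IsSymmetricGen η inv) :
    StronglyNegligible {w : List α | evalWord η w ∈ P} ↔
      3 ≤ Cardinal.mk (H ⧸ φ.range) := by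
  have hinj : ∀ i, Function.Injective (amalgMaps φ ψ i) := by
    intro i
    cases i
    · exact hψ
    · exact hφ
  obtain ⟨k, hk⟩ := exists_notMem_range ψ hK2
  have hne : Nonempty α := by
    by_contra hα
    rw [not_nonempty_iff] at hα
    have h1 := hsym.2.2.2
    rw [Set.range_eq_empty, Subgroup.closure_empty] at h1
    have h2 : amalgK φ ψ k ∈ (⊥ : Subgroup (AmalgProd φ ψ)) := by rw [h1]; trivial
    rw [Subgroup.mem_bot] at h2
    have h3 : Function.Injective (amalgK φ ψ) := Monoid.PushoutI.of_injective hinj false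
    have h4 : k = 1 := h3 (by rw [h2, map_one])
    exact hk (h4 ▸ one_mem _)
  constructor
  · intro hneg
    by_contra h3
    have eH : φ.range.index = 2 := card_eq_two (hK2.trans hHK) h3
    have eK : ψ.range.index = 2 := card_eq_two hK2 (fun h => h3 (h.trans hHK))
    refine not_negligible_amalg (amalgMaps φ ψ) (fun i => ?_) P ?_ η inv hsym hneg
    · cases i
      · exact eK
      · exact eH
    · rintro _ ⟨b, rfl⟩
      rcases hP with rfl | rfl
      · exact ⟨φ b, Monoid.PushoutI.of_apply_eq_base (amalgMaps φ ψ) true b⟩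
      · exact ⟨ψ b, Monoid.PushoutI.of_apply_eq_base (amalgMaps φ ψ) false b⟩
  · intro h3
    obtain ⟨x, y, hx, hy, hxy⟩ := exists_two_notMem_range φ h3
    rcases hP with rfl | rfl
    · exact negligible_amalg (amalgMaps φ ψ) hinj k hk x y hx hy hxy true η inv hsym
    · exact negligible_amalg (amalgMaps φ ψ) hinj k hk x y hx hy hxy false η inv hsym
end

section
/- Let G = ⟨H, t | t a t⁻¹ = φ(a) for a ∈ A⟩ be an HNN extension with [H : A] ≥ 2 and [H : B] ≥ 2, and let η : Σ → G be any map from a finite set Σ whose image generates G as a monoid. Then the set of words over Σ representing elliptic elements of G is strongly negligible; equivalently, the set of words representing hyperbolic elements is strongly generic. -/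
universe u

open Monoid

/-- An element of `G` is elliptic with respect to the set `S` if it is conjugate in `G`
to an element of `S`. -/
def IsElliptic {G : Type*} [Group G] (S : Set G) (x : G) : Prop :=
  ∃ h ∈ S, IsConj h x

namespace HNNNeg

open HNNExtension HNNExtension.NormalWord

section length

variable {H : Type*} [Group H] {A B : Subgroup H} (φ : A ≃* B)

/-- A fixed choice of transversals. -/
noncomputable def dd (A B : Subgroup H) : TransversalPair H A B := Classical.choice inferInstance

/-- The number of stable letters in the normal form. -/
noncomputable def tlen (g : HNNExtension H A B φ) : ℕ :=
  (g • (NormalWord.empty : NormalWord (dd A B))).toList.length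

theorem tlen_of_mul (h : H) (g : HNNExtension H A B φ) : tlen φ (of h * g) = tlen φ g := by
  simp [tlen, mul_smul, of_smul_eq_smul]

theorem length_unitsSMul_cancel (u : ℤˣ) (w : NormalWord (dd A B)) (h : Cancels u w) :
    (unitsSMul φ u w).toList.length + 1 = w.toList.length := by
  rw [unitsSMul, dif_pos h]
  cases w using consRecOn with
  | ofGroup g => simp [Cancels] at h
  | cons g u' w h1 h2 => simp [unitsSMulWithCancel]

theorem length_unitsSMul_not_cancel (u : ℤˣ) (w : NormalWord (dd A B)) (h : ¬ Cancels u w) :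
    (unitsSMul φ u w).toList.length = w.toList.length + 1 := by
  rw [unitsSMul, dif_neg h]
  simp

theorem tlen_t_mul (u : ℤˣ) (g : HNNExtension H A B φ) :
    tlen φ (t ^ (u : ℤ) * g) = tlen φ g + 1 ∨ tlen φ (t ^ (u : ℤ) * g) + 1 = tlen φ g := by
  simp only [tlen, mul_smul, t_pow_smul_eq_unitsSMul]
  by_cases h : Cancels u (g • (NormalWord.empty : NormalWord (dd A B)))
  · exact Or.inr (length_unitsSMul_cancel φ u _ h)
  · exact Or.inl (length_unitsSMul_not_cancel φ u _ h)

theorem tlen_lt_iff (u : ℤˣ) (g : HNNExtension H A B φ) :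
    tlen φ (t ^ (u : ℤ) * g) < tlen φ g ↔
      Cancels u (g • (NormalWord.empty : NormalWord (dd A B))) := by
  simp only [tlen, mul_smul, t_pow_smul_eq_unitsSMul]
  by_cases h : Cancels u (g • (NormalWord.empty : NormalWord (dd A B)))
  · have := length_unitsSMul_cancel φ u _ h
    simp only [h, iff_true]; omega
  · have := length_unitsSMul_not_cancel φ u _ h
    simp only [h, iff_false]; omega

theorem tlen_unique (u v : ℤˣ) (h : H) (g : HNNExtension H A B φ)
    (h1 : tlen φ (t ^ (u : ℤ) * g) < tlen φ g)
    (h2 : tlen φ (t ^ (v : ℤ) * (of h * g)) < tlen φ g) :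
    u = v ∧ h ∈ toSubgroup A B u := by
  rw [← tlen_of_mul φ h g] at h2
  rw [tlen_lt_iff] at h1 h2
  rw [mul_smul, of_smul_eq_smul] at h2
  obtain ⟨a1, a2⟩ := h1
  obtain ⟨b1, b2⟩ := h2
  have huv : u = v := by
    simp only [group_smul_toList] at b2
    rw [a2] at b2
    simpa using b2
  subst huv
  refine ⟨rfl, ?_⟩
  simp only [group_smul_head] at b1
  exact (Subgroup.mul_mem_cancel_right _ a1).1 b1

theorem tlen_eq_zero (g : HNNExtension H A B φ) : tlen φ g = 0 ↔ ∃ h, g = of h := by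
  constructor
  · intro h
    refine ⟨(g • (NormalWord.empty : NormalWord (dd A B))).head, ?_⟩
    have h3 := prod_smul φ g (NormalWord.empty : NormalWord (dd A B))
    rw [prod_empty, mul_one] at h3
    rw [tlen, List.length_eq_zero_iff] at h
    conv_lhs => rw [← h3]
    simp [ReducedWord.prod, h]
  · rintro ⟨h, rfl⟩
    simp [tlen, of_smul_eq_smul]

theorem tlen_exists (g : HNNExtension H A B φ) (hg : tlen φ g ≠ 0) :
    ∃ (h : H) (u : ℤˣ), tlen φ (t ^ (u : ℤ) * (of h * g)) < tlen φ g := by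
  set w := g • (NormalWord.empty : NormalWord (dd A B)) with hw
  obtain ⟨⟨u, x⟩, l, hl⟩ : ∃ p l, w.toList = p :: l := by
    rcases hl : w.toList with _ | ⟨p, l⟩
    · exact absurd (by simp [tlen, ← hw, hl]) hg
    · exact ⟨p, l, rfl⟩
  refine ⟨w.head⁻¹, -u, ?_⟩
  rw [← tlen_of_mul φ w.head⁻¹ g]
  refine (tlen_lt_iff φ (-u) _).2 ?_
  rw [mul_smul, of_smul_eq_smul]
  constructor
  · simp [← hw]
  · simp [← hw, hl]

theorem tlen_mul (x y : HNNExtension H A B φ) : tlen φ (x * y) ≤ tlen φ x + tlen φ y := by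
  induction hn : tlen φ x using Nat.strong_induction_on generalizing x with
  | _ n ih =>
    subst hn
    by_cases h0 : tlen φ x = 0
    · obtain ⟨h, rfl⟩ := (tlen_eq_zero φ x).1 h0
      rw [tlen_of_mul]; omega
    · obtain ⟨h, u, hu⟩ := tlen_exists φ x h0
      have := ih _ hu _ rfl
      have h3 := tlen_t_mul φ u (of h * (x * y))
      rw [tlen_of_mul] at h3
      simp only [mul_assoc] at *
      omega

theorem tlen_of (h : H) : tlen φ (of h) = 0 := (tlen_eq_zero φ _).2 ⟨h, rfl⟩

theorem tlen_mul_of (h : H) (g : HNNExtension H A B φ) : tlen φ (g * of h) = tlen φ g := by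
  have h1 := tlen_mul φ g (of h)
  have h2 := tlen_mul φ (g * of h) (of h⁻¹)
  rw [tlen_of] at h1 h2
  rw [mul_assoc, ← map_mul, mul_inv_cancel, map_one, mul_one] at h2
  omega

theorem tlen_t (u : ℤˣ) : tlen φ (t ^ (u : ℤ)) = 1 := by
  have := tlen_t_mul φ u (of 1)
  rw [tlen_of, map_one, mul_one] at this
  omega

theorem t_conj_of (u : ℤˣ) (h : H) (hh : h ∈ toSubgroup A B u) :
    ∃ h', (t ^ (u : ℤ) * of h : HNNExtension H A B φ) = of h' * t ^ (u : ℤ) := by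
  rcases Int.units_eq_one_or u with rfl | rfl
  · exact ⟨φ ⟨h, hh⟩, by simpa using t_mul_of (φ := φ) ⟨h, hh⟩⟩
  · exact ⟨φ.symm ⟨h, hh⟩, by simpa using inv_t_mul_of (φ := φ) ⟨h, hh⟩⟩

/-- Letters: elements of the base or stable letters. -/
def IsLetter (x : HNNExtension H A B φ) : Prop := (∃ h, x = of h) ∨ ∃ u : ℤˣ, x = t ^ (u : ℤ)

theorem letter_step (v : ℤˣ) (z x : HNNExtension H A B φ) (hx : IsLetter φ x)
    (hz : tlen φ (t ^ (v : ℤ) * z) < tlen φ z) (h0 : tlen φ (z * x) ≠ 0) :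
    tlen φ (t ^ (v : ℤ) * (z * x)) < tlen φ (z * x) := by
  rcases hx with ⟨h, rfl⟩ | ⟨w, rfl⟩
  · rwa [← mul_assoc, tlen_mul_of, tlen_mul_of]
  · obtain ⟨h, u, hu⟩ := tlen_exists φ _ h0
    have e : z = z * t ^ (w : ℤ) * t ^ ((-w : ℤˣ) : ℤ) := by simp
    by_cases hlt : tlen φ (z * t ^ (w : ℤ)) < tlen φ z
    · have h1 := tlen_mul φ (t ^ (u : ℤ) * (of h * (z * t ^ (w : ℤ)))) (t ^ ((-w : ℤˣ) : ℤ))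
      rw [tlen_t] at h1
      have e2 : t ^ (u : ℤ) * (of h * (z * t ^ (w : ℤ))) * t ^ ((-w : ℤˣ) : ℤ)
          = t ^ (u : ℤ) * (of h * z) := by simp [mul_assoc]
      rw [e2] at h1
      obtain ⟨rfl, hh⟩ := tlen_unique φ v u h z hz (by omega)
      obtain ⟨h', hh'⟩ := t_conj_of φ v h hh
      rwa [← mul_assoc, hh', mul_assoc, tlen_of_mul] at hu
    · have h1 := tlen_mul φ (t ^ (v : ℤ) * z) (t ^ (w : ℤ))
      rw [tlen_t] at h1
      have h3 := tlen_t_mul φ v (z * t ^ (w : ℤ))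
      rw [mul_assoc] at h1
      omega

theorem list_step (v : ℤˣ) (L : List (HNNExtension H A B φ)) (hL : ∀ x ∈ L, IsLetter φ x)
    (z : HNNExtension H A B φ) (hz : tlen φ (t ^ (v : ℤ) * z) < tlen φ z) :
    (∃ L1 L2, L = L1 ++ L2 ∧ tlen φ (z * L1.prod) = 0) ∨
      tlen φ (t ^ (v : ℤ) * (z * L.prod)) < tlen φ (z * L.prod) := by
  induction L generalizing z with
  | nil => right; simpa using hz
  | cons x L ih =>
    by_cases h0 : tlen φ (z * x) = 0
    · exact Or.inl ⟨[x], L, rfl, by simpa using h0⟩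
    · have := letter_step φ v z x (hL x (by simp)) hz h0
      rcases ih (fun y hy => hL y (by simp [hy])) _ this with ⟨L1, L2, rfl, h⟩ | h
      · exact Or.inl ⟨x :: L1, L2, rfl, by simpa [mul_assoc] using h⟩
      · right; simpa [mul_assoc] using h

/-- If a product of letters is elliptic then some cyclic permutation lies in the base. -/
theorem elliptic_split (L : List (HNNExtension H A B φ)) (hL : ∀ x ∈ L, IsLetter φ x)
    (x : HNNExtension H A B φ) (hx : tlen φ (x⁻¹ * L.prod * x) = 0) :
    ∃ L1 L2, L = L1 ++ L2 ∧ tlen φ (L2.prod * L1.prod) = 0 := by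
  induction hn : tlen φ x⁻¹ using Nat.strong_induction_on generalizing x with
  | _ n ih =>
    subst hn
    by_cases h0 : tlen φ x⁻¹ = 0
    · obtain ⟨h, hh⟩ := (tlen_eq_zero φ _).1 h0
      have hx2 : x = of h⁻¹ := by rw [map_inv, ← hh, inv_inv]
      refine ⟨[], L, rfl, ?_⟩
      rw [hx2, tlen_mul_of, ← map_inv, tlen_of_mul] at hx
      simpa using hx
    · obtain ⟨h, v, hv⟩ := tlen_exists φ _ h0
      set k := x * of h⁻¹ with hk
      have hki : k⁻¹ = of h * x⁻¹ := by simp [hk]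
      have hkk : tlen φ (k⁻¹ * L.prod * k) = 0 := by
        rw [hki, hk, ← mul_assoc, tlen_mul_of, mul_assoc, mul_assoc, tlen_of_mul, ← mul_assoc]
        exact hx
      have hkl : tlen φ k⁻¹ = tlen φ x⁻¹ := by rw [hki, tlen_of_mul]
      rw [← hki, ← hkl] at hv
      obtain ⟨h', hh'⟩ := (tlen_eq_zero φ _).1 hkk
      rcases list_step φ v L hL k⁻¹ hv with ⟨L1, L2, rfl, h1⟩ | h1
      · refine ⟨L1, L2, rfl, ?_⟩
        obtain ⟨h2, hh2⟩ := (tlen_eq_zero φ _).1 h1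
        rw [List.prod_append] at hh'
        have e : L2.prod * L1.prod = of (h2⁻¹ * h' * h2) := by
          rw [map_mul, map_mul, map_inv, ← hh2, ← hh']
          group
        rw [e, tlen_of]
      · have e : k⁻¹ * L.prod = of h' * k⁻¹ := by rw [← hh']; group
        rw [e, tlen_of_mul] at h1
        obtain ⟨_, hm⟩ := tlen_unique φ v v h' _ hv h1
        obtain ⟨h3, hh3⟩ := t_conj_of φ v h' hm
        refine ih (tlen φ (t ^ (v : ℤ) * k⁻¹)) (by omega) (k * t ^ (-(v : ℤ))) ?_ (by simp)
        have e3 : (k * t ^ (-(v : ℤ)))⁻¹ * L.prod * (k * t ^ (-(v : ℤ))) = of h3 := by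
          calc _ = t ^ (v : ℤ) * (k⁻¹ * L.prod * k) * t ^ (-(v : ℤ)) := by group
            _ = of h3 := by rw [hh', hh3]; group
        rw [e3, tlen_of]

theorem exists_letters (g : HNNExtension H A B φ) :
    ∃ L : List (HNNExtension H A B φ), (∀ x ∈ L, IsLetter φ x) ∧ L.prod = g := by
  induction hn : tlen φ g using Nat.strong_induction_on generalizing g with
  | _ n ih =>
    subst hn
    by_cases h0 : tlen φ g = 0
    · obtain ⟨h, hh⟩ := (tlen_eq_zero φ _).1 h0
      exact ⟨[g], by simp [IsLetter, hh], by simp⟩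
    · obtain ⟨h, u, hu⟩ := tlen_exists φ g h0
      obtain ⟨L, hL, hp⟩ := ih _ hu _ rfl
      refine ⟨of h⁻¹ :: t ^ ((-u : ℤˣ) : ℤ) :: L, ?_, by simp [hp]⟩
      intro x hx
      rcases List.mem_cons.1 hx with rfl | hx
      · exact Or.inl ⟨_, rfl⟩
      rcases List.mem_cons.1 hx with rfl | hx
      · exact Or.inr ⟨_, rfl⟩
      exact hL x hx

end length

end HNNNeg
namespace HNNNeg

open scoped NNReal ENNReal

section ell2

variable {G X : Type*} [Group G] [MulAction G X]

/-- Squared `ℓ²` norm. -/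
noncomputable def sqn (f : X → ℝ≥0) : ℝ≥0∞ := ∑' x, ((f x ^ 2 : ℝ≥0) : ℝ≥0∞)

theorem sqn_smul (g : G) (f : X → ℝ≥0) : sqn (fun x => f (g⁻¹ • x)) = sqn f :=
  Equiv.tsum_eq (MulAction.toPerm g⁻¹) (fun x => ((f x ^ 2 : ℝ≥0) : ℝ≥0∞))

theorem pingpong_pointwise {ι : Type*} [Fintype ι] (a b c : ι → ℝ≥0) (h : ∀ i, c i = a i + b i)
    (hb : ∀ i j, i ≠ j → b i = 0 ∨ b j = 0) :
    (∑ i, c i) ^ 2 ≤ 2 * Fintype.card ι * ∑ i, a i ^ 2 + 2 * ∑ i, c i ^ 2 := by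
  classical
  have h1 : (∑ i, a i) ^ 2 ≤ Fintype.card ι * ∑ i, a i ^ 2 := by
    simpa using sq_sum_le_card_mul_sum_sq (s := Finset.univ) (f := a)
  have h2 : (∑ i, b i) ^ 2 ≤ ∑ i, c i ^ 2 := by
    by_cases hall : ∀ i, b i = 0
    · simp [hall]
    · push Not at hall
      obtain ⟨i, hi⟩ := hall
      have : ∑ j, b j = b i := by
        refine Finset.sum_eq_single i (fun j _ hj => ?_) (by simp)
        rcases hb i j hj.symm with h | h
        · exact absurd h hi
        · exact h
      rw [this]
      calc b i ^ 2 ≤ c i ^ 2 := by rw [h]; gcongr; exact le_add_self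
        _ ≤ _ := Finset.single_le_sum (f := fun i => c i ^ 2) (fun _ _ => zero_le) (Finset.mem_univ i)
  have h3 : ∑ i, c i = ∑ i, a i + ∑ i, b i := by
    rw [← Finset.sum_add_distrib]; exact Finset.sum_congr rfl fun i _ => h i
  rw [h3]
  calc (∑ i, a i + ∑ i, b i) ^ 2 ≤ 2 * (∑ i, a i) ^ 2 + 2 * (∑ i, b i) ^ 2 := by
        have := add_sq_le (a := ∑ i, a i) (b := ∑ i, b i)
        rwa [mul_add] at this
    _ ≤ _ := by rw [mul_assoc]; gcongr

theorem sqn_pingpong {ι : Type*} [Fintype ι] (s : ι → G) (R A : ι → Set X)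
    (hR : ∀ i j x, x ∈ R i → x ∈ R j → i = j) (hA : ∀ i j x, x ∈ A i → x ∈ A j → i = j)
    (hs : ∀ i x, x ∉ R i → s i • x ∈ A i) (f : X → ℝ≥0) :
    sqn (fun x => ∑ i, f ((s i)⁻¹ • x)) ≤ 4 * Fintype.card ι * sqn f := by
  classical
  let r : ι → X → ℝ≥0 := fun i => (R i).indicator f
  have key : ∀ y, (∑ i, f ((s i)⁻¹ • y)) ^ 2 ≤
      2 * Fintype.card ι * ∑ i, r i ((s i)⁻¹ • y) ^ 2 + 2 * ∑ i, f ((s i)⁻¹ • y) ^ 2 := by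
    intro y
    refine pingpong_pointwise _ (fun i => (R i)ᶜ.indicator f ((s i)⁻¹ • y)) _ ?_ ?_
    · intro i
      exact (Set.indicator_self_add_compl_apply (R i) f _).symm
    · intro i j hij
      by_contra! hne
      have h1 := Set.mem_of_indicator_ne_zero hne.1
      have h2 := Set.mem_of_indicator_ne_zero hne.2
      have h3 := hs i _ h1
      have h4 := hs j _ h2
      rw [smul_inv_smul] at h3 h4
      exact hij (hA _ _ _ h3 h4)
  have hr : ∑ i, sqn (r i) ≤ sqn f := by
    unfold sqn
    rw [← Summable.tsum_finsetSum (fun _ _ => ENNReal.summable)]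
    refine ENNReal.tsum_le_tsum fun x => ?_
    rw [← ENNReal.ofNNReal_finsetSum]
    norm_cast
    by_cases hx : ∃ i, x ∈ R i
    · obtain ⟨i, hi⟩ := hx
      rw [Finset.sum_eq_single i]
      · simp [r, hi]
      · intro j _ hj
        have : x ∉ R j := fun h => hj (hR _ _ _ h hi)
        simp [r, this]
      · simp
    · push Not at hx
      simp [r, hx]
  calc sqn (fun x => ∑ i, f ((s i)⁻¹ • x))
      ≤ ∑' y, ((2 * Fintype.card ι * ∑ i, r i ((s i)⁻¹ • y) ^ 2
          + 2 * ∑ i, f ((s i)⁻¹ • y) ^ 2 : ℝ≥0) : ℝ≥0∞) :=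
        ENNReal.tsum_le_tsum fun y => ENNReal.coe_le_coe.2 (key y)
    _ = 2 * Fintype.card ι * ∑ i, sqn (r i) + 2 * ∑ i : ι, sqn f := by
        simp only [ENNReal.coe_add, ENNReal.coe_mul, ENNReal.ofNNReal_finsetSum]
        rw [ENNReal.tsum_add, ENNReal.tsum_mul_left, ENNReal.tsum_mul_left,
          Summable.tsum_finsetSum (fun _ _ => ENNReal.summable),
          Summable.tsum_finsetSum (fun _ _ => ENNReal.summable)]
        congr 2
        refine Finset.sum_congr rfl fun i _ => ?_
        · exact sqn_smul (s i) (r i)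
        · refine Finset.sum_congr rfl fun i _ => ?_
          exact sqn_smul (s i) f
    _ ≤ 2 * Fintype.card ι * sqn f + 2 * ∑ i : ι, sqn f := by gcongr
    _ = _ := by
        simp only [Finset.sum_const, Finset.card_univ, nsmul_eq_mul]
        ring

end ell2

section words

variable {α : Type*} [Fintype α]

/-- The map `(a, w) ↦ a :: w` as an embedding. -/
def consEmb {α : Type*} : α × List α ↪ List α :=
  ⟨fun p => p.1 :: p.2, by rintro ⟨a, l⟩ ⟨b, m⟩ h; simpa using h⟩

theorem consEmb_apply {α : Type*} (a : α) (w : List α) : consEmb (a, w) = a :: w := rfl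

/-- Words of length `n`. -/
def W (α : Type*) [Fintype α] : ℕ → Finset (List α)
  | 0 => {[]}
  | n + 1 => (Finset.univ ×ˢ W α n).map consEmb

theorem mem_W {n : ℕ} {w : List α} : w ∈ W α n ↔ w.length = n := by
  induction n generalizing w with
  | zero => simp [W]
  | succ n ih =>
    cases w with
    | nil => simp [W, consEmb_apply]
    | cons a w => simp [W, ih, consEmb_apply]

theorem card_W (n : ℕ) : (W α n).card = Fintype.card α ^ n := by
  induction n with
  | zero => simp [W]
  | succ n ih => simp [W, ih, pow_succ, mul_comm]

theorem sum_W_succ {M : Type*} [AddCommMonoid M] (n : ℕ) (F : List α → M) :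
    ∑ w ∈ W α (n + 1), F w = ∑ a, ∑ w ∈ W α n, F (a :: w) := by
  simp [W, Finset.sum_product, consEmb_apply]

variable {G X : Type*} [Group G] [MulAction G X] (η : α → G)

/-- The (unnormalised) transition operator. -/
noncomputable def T (f : X → ℝ≥0) : X → ℝ≥0 := fun x => ∑ a, f ((η a)⁻¹ • x)

theorem T_iter (n : ℕ) (f : X → ℝ≥0) (x : X) :
    (T η)^[n] f x = ∑ w ∈ W α n, f ((evalWord η w)⁻¹ • x) := by
  induction n generalizing x with
  | zero => simp [W, evalWord]
  | succ n ih =>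
    rw [Function.iterate_succ_apply', sum_W_succ]
    simp only [T, ih]
    refine Finset.sum_congr rfl fun a _ => Finset.sum_congr rfl fun w _ => ?_
    simp [evalWord, mul_smul]

theorem sqn_T (f : X → ℝ≥0) : sqn (T η f) ≤ (Fintype.card α ^ 2 : ℕ) * sqn f := by
  calc sqn (T η f) ≤ ∑' x, ((Fintype.card α * ∑ a, f ((η a)⁻¹ • x) ^ 2 : ℝ≥0) : ℝ≥0∞) := by
        refine ENNReal.tsum_le_tsum fun x => ENNReal.coe_le_coe.2 ?_
        simpa [T] using sq_sum_le_card_mul_sum_sq (s := Finset.univ)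
          (f := fun a => f ((η a)⁻¹ • x))
    _ = Fintype.card α * ∑ a : α, sqn f := by
        simp only [ENNReal.coe_mul, ENNReal.ofNNReal_finsetSum]
        rw [ENNReal.tsum_mul_left, Summable.tsum_finsetSum (fun _ _ => ENNReal.summable)]
        congr 1
        exact Finset.sum_congr rfl fun a _ => sqn_smul (η a) f
    _ = _ := by
        simp only [Finset.sum_const, Finset.card_univ, nsmul_eq_mul]
        push_cast
        ring

theorem sqn_T_iter {ι : Type*} [Fintype ι] (hcard : Fintype.card ι = 8)
    (R A : ι → Set X)
    (hR : ∀ i j x, x ∈ R i → x ∈ R j → i = j) (hA : ∀ i j x, x ∈ A i → x ∈ A j → i = j)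
    (K : ℕ) (v : ι → List α) (hv : Function.Injective v) (hvK : ∀ i, (v i).length = K)
    (hs : ∀ i x, x ∉ R i → evalWord η (v i) • x ∈ A i) :
    ∃ m : ℕ, Fintype.card α ^ K = m + 8 ∧ ∀ f : X → ℝ≥0,
      sqn ((T η)^[K] f) ≤ ((m + 8) * (m + 4) : ℕ) * sqn f := by
  classical
  set S : Finset (List α) := Finset.univ.image v with hS
  have hSW : S ⊆ W α K := by
    intro w hw
    obtain ⟨i, -, rfl⟩ := Finset.mem_image.1 hw
    exact mem_W.2 (hvK i)
  have hSc : S.card = 8 := by rw [hS, Finset.card_image_of_injective _ hv, Finset.card_univ, hcard]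
  have hM : (W α K).card = (W α K \ S).card + 8 := by
    rw [← hSc, Finset.card_sdiff_add_card_eq_card hSW]
  refine ⟨(W α K \ S).card, by rw [← hM, card_W], fun f => ?_⟩
  set m := (W α K \ S).card with hm
  have key : ∀ x, ((T η)^[K] f x) ^ 2 ≤ (m + 8 : ℝ≥0) *
      (∑ w ∈ W α K \ S, f ((evalWord η w)⁻¹ • x) ^ 2 +
        8⁻¹ * (∑ i, f ((evalWord η (v i))⁻¹ • x)) ^ 2) := by
    intro x
    rw [T_iter]
    set y := ∑ i, f ((evalWord η (v i))⁻¹ • x) with hy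
    have hyS : ∑ w ∈ S, f ((evalWord η w)⁻¹ • x) = y := by
      rw [hS, Finset.sum_image (fun i _ j _ h => hv h)]
    let c : List α → ℝ≥0 := fun w => if w ∈ S then y / 8 else f ((evalWord η w)⁻¹ • x)
    have e1 : ∑ w ∈ W α K, f ((evalWord η w)⁻¹ • x) = ∑ w ∈ W α K, c w := by
      rw [← Finset.sum_sdiff hSW, ← Finset.sum_sdiff hSW, hyS]
      congr 1
      · refine Finset.sum_congr rfl fun w hw => ?_
        simp [c, (Finset.mem_sdiff.1 hw).2]
      · rw [Finset.sum_congr rfl (g := fun _ => y / 8) (fun w hw => by simp [c, hw])]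
        simp only [Finset.sum_const, hSc, nsmul_eq_mul]
        field_simp
        norm_num
    have e2 : ∑ w ∈ W α K, c w ^ 2 = ∑ w ∈ W α K \ S, f ((evalWord η w)⁻¹ • x) ^ 2 +
        8⁻¹ * y ^ 2 := by
      rw [← Finset.sum_sdiff hSW]
      congr 1
      · refine Finset.sum_congr rfl fun w hw => ?_
        simp [c, (Finset.mem_sdiff.1 hw).2]
      · rw [Finset.sum_congr rfl (g := fun _ => (y / 8) ^ 2) (fun w hw => by simp [c, hw])]
        simp only [Finset.sum_const, hSc, nsmul_eq_mul]
        field_simp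
        norm_num
        ring
    rw [e1, ← e2]
    have := sq_sum_le_card_mul_sum_sq (s := W α K) (f := c)
    rw [hM] at this
    exact_mod_cast this
  have pp := sqn_pingpong (fun i => evalWord η (v i)) R A hR hA hs f
  rw [hcard] at pp
  calc sqn ((T η)^[K] f) ≤ ∑' x, (((m + 8 : ℝ≥0) *
      (∑ w ∈ W α K \ S, f ((evalWord η w)⁻¹ • x) ^ 2 +
        8⁻¹ * (∑ i, f ((evalWord η (v i))⁻¹ • x)) ^ 2) : ℝ≥0) : ℝ≥0∞) :=
        ENNReal.tsum_le_tsum fun x => ENNReal.coe_le_coe.2 (key x)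
    _ = ((m + 8 : ℝ≥0) : ℝ≥0∞) * (∑ w ∈ W α K \ S, sqn f +
          ((8⁻¹ : ℝ≥0) : ℝ≥0∞) * sqn (fun x => ∑ i, f ((evalWord η (v i))⁻¹ • x))) := by
        simp only [ENNReal.coe_mul, ENNReal.coe_add _ (8⁻¹ * _), ENNReal.ofNNReal_finsetSum]
        rw [ENNReal.tsum_mul_left, ENNReal.tsum_add, ENNReal.tsum_mul_left,
          Summable.tsum_finsetSum (fun _ _ => ENNReal.summable)]
        congr 2
        exact Finset.sum_congr rfl fun w _ => sqn_smul (evalWord η w) f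
    _ ≤ ((m + 8 : ℝ≥0) : ℝ≥0∞) * (∑ w ∈ W α K \ S, sqn f +
          ((8⁻¹ : ℝ≥0) : ℝ≥0∞) * (4 * (8 : ℕ) * sqn f)) := by gcongr
    _ = _ := by
        have : ((8⁻¹ : ℝ≥0) : ℝ≥0∞) * (4 * (8 : ℕ) * sqn f) = 4 * sqn f := by
          rw [← mul_assoc]
          congr 1
          rw [show ((4 : ℝ≥0∞) * (8 : ℕ)) = ((32 : ℝ≥0) : ℝ≥0∞) by norm_num, ← ENNReal.coe_mul,
            show (8⁻¹ : ℝ≥0) * 32 = 4 by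
              rw [inv_mul_eq_iff_eq_mul₀ (by norm_num)]; norm_num]
          norm_num
        rw [this]
        simp only [Finset.sum_const, ← hm, nsmul_eq_mul]
        push_cast
        ring

end words

end HNNNeg
namespace HNNNeg

open scoped NNReal ENNReal

section decay

variable {α : Type*} [Fintype α] {G X : Type*} [Group G] [MulAction G X] (η : α → G)

theorem sqn_T_iter_le (N : ℕ) (hN : Fintype.card α = N) (r : ℕ) (f : X → ℝ≥0) :
    sqn ((T η)^[r] f) ≤ (N ^ (2 * r) : ℕ) * sqn f := by
  induction r with
  | zero => simp
  | succ r ih =>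
    rw [Function.iterate_succ_apply']
    calc _ ≤ _ := sqn_T η _
      _ ≤ (Fintype.card α ^ 2 : ℕ) * ((N ^ (2 * r) : ℕ) * sqn f) := by gcongr
      _ = _ := by rw [hN]; push_cast; ring

theorem sqn_T_iter_mul (K θ : ℕ) (hθ : ∀ f : X → ℝ≥0, sqn ((T η)^[K] f) ≤ (θ : ℝ≥0∞) * sqn f)
    (q : ℕ) (f : X → ℝ≥0) :
    sqn ((T η)^[K * q] f) ≤ (θ ^ q : ℕ) * sqn f := by
  induction q with
  | zero => simp
  | succ q ih =>
    rw [Nat.mul_succ, add_comm, Function.iterate_add_apply]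
    calc _ ≤ _ := hθ _
      _ ≤ (θ : ℝ≥0∞) * ((θ ^ q : ℕ) * sqn f) := by gcongr
      _ = _ := by push_cast; ring

open Classical in
theorem count_sq_le (K m : ℕ) (hm : Fintype.card α ^ K = m + 8)
    (hθ : ∀ f : X → ℝ≥0, sqn ((T η)^[K] f) ≤ ((m + 8) * (m + 4) : ℕ) * sqn f)
    (x y : X) (n : ℕ) :
    ((W α n).filter (fun w => evalWord η w • x = y)).card ^ 2 ≤
      Fintype.card α ^ (2 * (n % K)) * ((m + 8) * (m + 4)) ^ (n / K) := by
  set δ : X → ℝ≥0 := fun z => if z = x then 1 else 0 with hδ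
  have h1 : sqn δ = 1 := by
    unfold sqn
    rw [tsum_eq_single x]
    · simp [hδ]
    · intro b hb; simp [hδ, hb]
  have h2 : (T η)^[n] δ y = (((W α n).filter (fun w => evalWord η w • x = y)).card : ℝ≥0) := by
    rw [T_iter, Finset.card_filter]
    push_cast
    refine Finset.sum_congr rfl fun w _ => ?_
    simp only [hδ, inv_smul_eq_iff, eq_comm (a := y)]
  have h3 : sqn ((T η)^[n] δ) ≤
      ((Fintype.card α ^ (2 * (n % K)) * ((m + 8) * (m + 4)) ^ (n / K) : ℕ) : ℝ≥0∞) := by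
    conv_lhs => rw [← Nat.mod_add_div n K, Function.iterate_add_apply]
    calc _ ≤ _ := sqn_T_iter_le η _ rfl _ _
      _ ≤ (Fintype.card α ^ (2 * (n % K)) : ℕ) *
          ((((m + 8) * (m + 4)) ^ (n / K) : ℕ) * sqn δ) := by
        gcongr
        exact sqn_T_iter_mul η K _ hθ _ _
      _ = _ := by rw [h1]; push_cast; ring
  have h4 : (((T η)^[n] δ y ^ 2 : ℝ≥0) : ℝ≥0∞) ≤ sqn ((T η)^[n] δ) :=
    ENNReal.le_tsum (f := fun z => (((T η)^[n] δ z ^ 2 : ℝ≥0) : ℝ≥0∞)) y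
  rw [h2] at h4
  have h5 := h4.trans h3
  exact_mod_cast h5

open Classical in
theorem count_le {ι : Type*} [Fintype ι] (hcard : Fintype.card ι = 8)
    (R A : ι → Set X)
    (hR : ∀ i j x, x ∈ R i → x ∈ R j → i = j) (hA : ∀ i j x, x ∈ A i → x ∈ A j → i = j)
    (K : ℕ) (v : ι → List α) (hv : Function.Injective v) (hvK : ∀ i, (v i).length = K)
    (hs : ∀ i x, x ∉ R i → evalWord η (v i) • x ∈ A i) :
    ∃ C ρ : ℝ, 0 < C ∧ 0 < ρ ∧ ρ < 1 ∧ ∀ (x y : X) (n : ℕ),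
      (((W α n).filter (fun w => evalWord η w • x = y)).card : ℝ) ≤
        C * ρ ^ n * (Fintype.card α : ℝ) ^ n := by
  obtain ⟨m, hm, hθ⟩ := sqn_T_iter η hcard R A hR hA K v hv hvK hs
  have hK : K ≠ 0 := by rintro rfl; simp at hm
  set N := Fintype.card α with hN
  set β : ℝ := ((m : ℝ) + 4) / (m + 8) with hβ
  have hβ0 : 0 < β := by positivity
  have hβ1 : β < 1 := by rw [hβ, div_lt_one (by positivity)]; linarith
  set ρ : ℝ := β ^ ((1 : ℝ) / (2 * K)) with hρ
  have hK' : (0 : ℝ) < K := by exact_mod_cast Nat.pos_of_ne_zero hK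
  have hρ0 : 0 < ρ := Real.rpow_pos_of_pos hβ0 _
  have hρ1 : ρ < 1 := Real.rpow_lt_one hβ0.le hβ1 (by positivity)
  have hρK : ρ ^ (2 * K) = β := by
    rw [hρ, ← Real.rpow_natCast, ← Real.rpow_mul hβ0.le]
    push_cast
    rw [one_div_mul_cancel (by positivity), Real.rpow_one]
  refine ⟨(ρ ^ K)⁻¹, ρ, by positivity, hρ0, hρ1, fun x y n => ?_⟩
  have h1 := count_sq_le η K m hm hθ x y n
  set c := ((W α n).filter (fun w => evalWord η w • x = y)).card
  have h2 : (c : ℝ) ^ 2 ≤ (N : ℝ) ^ (2 * (n % K)) * (((m : ℝ) + 8) * (m + 4)) ^ (n / K) := by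
    exact_mod_cast h1
  have h3 : (N : ℝ) ^ K = m + 8 := by exact_mod_cast hm
  have h4 : ((m : ℝ) + 8) * (m + 4) = N ^ (2 * K) * β := by
    rw [mul_comm 2 K, pow_mul, h3, hβ]
    field_simp
  have h5 : (c : ℝ) ^ 2 ≤ ((N : ℝ) ^ n * ρ ^ (K * (n / K))) ^ 2 := by
    refine h2.trans (le_of_eq ?_)
    rw [h4, mul_pow, ← hρK]
    conv_rhs => rw [← Nat.mod_add_div n K]
    have : (n % K + K * (n / K)) / K = n / K := by rw [Nat.mod_add_div]
    rw [this]
    ring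
  have h6 : (c : ℝ) ≤ (N : ℝ) ^ n * ρ ^ (K * (n / K)) :=
    le_of_sq_le_sq h5 (by positivity)
  refine h6.trans ?_
  have h7 : ρ ^ (K * (n / K)) * ρ ^ K ≤ ρ ^ n := by
    rw [← pow_add]
    refine pow_le_pow_of_le_one hρ0.le hρ1.le ?_
    have := Nat.lt_mul_div_succ n (Nat.pos_of_ne_zero hK)
    rw [Nat.mul_succ] at this
    omega
  have h8 : ρ ^ (K * (n / K)) ≤ (ρ ^ K)⁻¹ * ρ ^ n := by
    rw [← div_eq_inv_mul, le_div_iff₀ (by positivity)]; exact h7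
  rw [mul_comm]
  gcongr

end decay

section schottky

variable {α : Type*} [Fintype α] {G X : Type*} [Group G] [MulAction G X] (η : α → G)

theorem evalWord_append (v w : List α) : evalWord η (v ++ w) = evalWord η v * evalWord η w := by
  simp [evalWord]

theorem exists_word (hgen : Submonoid.closure (Set.range η) = ⊤) (g : G) :
    ∃ w : List α, evalWord η w = g := by
  have : g ∈ Submonoid.closure (Set.range η) := by rw [hgen]; trivial
  induction this using Submonoid.closure_induction with
  | mem x hx => obtain ⟨a, rfl⟩ := hx; exact ⟨[a], by simp [evalWord]⟩
  | one => exact ⟨[], by simp [evalWord]⟩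
  | mul x y _ _ hx hy =>
    obtain ⟨v, rfl⟩ := hx
    obtain ⟨w, rfl⟩ := hy
    exact ⟨v ++ w, evalWord_append η v w⟩

/-- Lengths of words representing the identity. -/
def idLengths : AddSubmonoid ℕ where
  carrier := {n | ∃ w : List α, evalWord η w = 1 ∧ w.length = n}
  zero_mem' := ⟨[], by simp [evalWord], rfl⟩
  add_mem' := by
    rintro m n ⟨v, hv, rfl⟩ ⟨w, hw, rfl⟩
    exact ⟨v ++ w, by rw [evalWord_append, hv, hw, one_mul], by simp⟩

/-- Conjugates of one element can be represented by words of the same length. -/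
theorem exists_conj_words (hgen : Submonoid.closure (Set.range η) = ⊤) {ι : Type*} [Fintype ι]
    (g : ι → G) (s : G) :
    ∃ (K : ℕ) (v : ι → List α), (∀ i, (v i).length = K) ∧
      ∀ i, evalWord η (v i) = g i * s * (g i)⁻¹ := by
  classical
  choose wd hwd using exists_word η hgen
  have hl : ∀ i, (wd (g i)).length + (wd (g i)⁻¹).length ∈ idLengths η := fun i =>
    ⟨wd (g i) ++ wd (g i)⁻¹, by rw [evalWord_append, hwd, hwd, mul_inv_cancel], by simp⟩
  have hpad : ∀ i, ∃ w : List α, evalWord η w = 1 ∧ w.length =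
      ∑ j ∈ Finset.univ.erase i, ((wd (g j)).length + (wd (g j)⁻¹).length) := fun i =>
    AddSubmonoid.sum_mem (idLengths η) (fun j _ => hl j)
  choose pad hpad1 hpad2 using hpad
  refine ⟨(wd s).length + ∑ j, ((wd (g j)).length + (wd (g j)⁻¹).length),
    fun i => wd (g i) ++ wd s ++ wd (g i)⁻¹ ++ pad i, fun i => ?_, fun i => ?_⟩
  · rw [← Finset.add_sum_erase _ _ (Finset.mem_univ i)]
    simp only [List.length_append, hpad2]
    omega
  · simp only [evalWord_append, hwd, hpad1, mul_one]

open Classical in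
theorem count_le_of_pingpong (hgen : Submonoid.closure (Set.range η) = ⊤)
    (t h : G) (C : ℤˣ → Set X) (x₀ : X)
    (hx₀ : ∀ u, x₀ ∉ C u) (hdisj : ∀ u v x, x ∈ C u → x ∈ C v → u = v)
    (ht : ∀ (u : ℤˣ) x, x ∉ C (-u) → t ^ (u : ℤ) • x ∈ C u)
    (hh : ∀ u v x, x ∈ C u → h • x ∉ C v) :
    ∃ C ρ : ℝ, 0 < C ∧ 0 < ρ ∧ ρ < 1 ∧ ∀ (x y : X) (n : ℕ),
      (((W α n).filter (fun w => evalWord η w • x = y)).card : ℝ) ≤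
        C * ρ ^ n * (Fintype.card α : ℝ) ^ n := by
  let D : Set X := {x | ∃ u, x ∈ C u}
  have hstep : ∀ (u : ℤˣ) x, x ∈ D → (t ^ (u : ℤ) * h) • x ∈ C u := by
    rintro u x ⟨v, hv⟩
    rw [mul_smul]
    exact ht u _ (hh _ _ _ hv)
  have hinj : ∀ (u v : ℤˣ) x y, x ∈ D → y ∈ D → (t ^ (u : ℤ) * h) • x = (t ^ (v : ℤ) * h) • y →
      u = v ∧ x = y := by
    intro u v x y hx hy hxy
    have h1 := hstep u x hx
    rw [hxy] at h1
    obtain rfl := hdisj _ _ _ h1 (hstep v y hy)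
    exact ⟨rfl, smul_left_cancel _ hxy⟩
  let g : ℤˣ × ℤˣ × ℤˣ → G := fun e =>
    (t ^ (e.1 : ℤ) * h) * ((t ^ (e.2.1 : ℤ) * h) * (t ^ (e.2.2 : ℤ) * h))
  have hg : ∀ e x, x ∈ D → g e • x ∈ D := by
    intro e x hx
    simp only [g, mul_smul (t ^ (e.1 : ℤ) * h), mul_smul (t ^ (e.2.1 : ℤ) * h)]
    exact ⟨_, hstep _ _ ⟨_, hstep _ _ ⟨_, hstep _ _ hx⟩⟩⟩
  have hgd : ∀ e e' x y, x ∈ D → y ∈ D → g e • x = g e' • y → e = e' := by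
    intro e e' x y hx hy hxy
    simp only [g, mul_smul (t ^ (_ : ℤ) * h) (_ * _)] at hxy
    have k1 := hinj _ _ _ _ ⟨_, hstep _ _ ⟨_, hstep _ _ hx⟩⟩ ⟨_, hstep _ _ ⟨_, hstep _ _ hy⟩⟩ hxy
    have k2 := hinj _ _ _ _ ⟨_, hstep _ _ hx⟩ ⟨_, hstep _ _ hy⟩ k1.2
    have k3 := hinj _ _ _ _ hx hy k2.2
    exact Prod.ext k1.1 (Prod.ext k2.1 k3.1)
  obtain ⟨K, v, hvK, hv⟩ := exists_conj_words η hgen g t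
  have hs : ∀ i x, x ∉ (fun y => g i • y) '' C (-1) →
      evalWord η (v i) • x ∈ (fun y => g i • y) '' C 1 := by
    intro i x hx
    refine ⟨t • (g i)⁻¹ • x, ?_, ?_⟩
    · have := ht 1 ((g i)⁻¹ • x) (fun hc => hx ⟨_, hc, by simp⟩)
      simpa using this
    · simp [hv, mul_smul]
  have hdis : ∀ w : ℤˣ, ∀ i j x, x ∈ (fun y => g i • y) '' C w →
      x ∈ (fun y => g j • y) '' C w → i = j := by
    rintro w i j x ⟨y, hy, rfl⟩ ⟨z, hz, hzz⟩
    exact (hgd j i z y ⟨_, hz⟩ ⟨_, hy⟩ hzz).symm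
  have hx0 : ∀ i, x₀ ∉ (fun y => g i • y) '' C (-1) := by
    rintro i ⟨y, hy, hyx⟩
    obtain ⟨u, hu⟩ := hg i y ⟨_, hy⟩
    exact hx₀ u (by rw [← hyx]; exact hu)
  refine count_le η (ι := ℤˣ × ℤˣ × ℤˣ) (by decide) (fun i => (fun y => g i • y) '' C (-1))
    (fun i => (fun y => g i • y) '' C 1) (hdis _) (hdis _) K v ?_ hvK hs
  intro i j hij
  have h1 := hs i x₀ (hx0 i)
  rw [hij] at h1
  exact hdis 1 i j _ h1 (hs j x₀ (hx0 j))

end schottky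

end HNNNeg
namespace HNNNeg

open HNNExtension HNNExtension.NormalWord

section tree

variable {H : Type*} [Group H] {A B : Subgroup H} (φ : A ≃* B)

/-- Distance of a vertex of the Bass-Serre tree to the base vertex. -/
noncomputable def vlen (x : HNNExtension H A B φ ⧸ (of : H →* HNNExtension H A B φ).range) : ℕ :=
  tlen φ x.out

theorem vlen_mk (g : HNNExtension H A B φ) :
    vlen φ (QuotientGroup.mk g) = tlen φ g := by
  obtain ⟨⟨_, h, rfl⟩, hr⟩ :=
    QuotientGroup.mk_out_eq_mul (of : H →* HNNExtension H A B φ).range g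
  rw [vlen, hr, tlen_mul_of]

theorem exists_not_mem_union (hA : A ≠ ⊤) (hB : B ≠ ⊤) : ∃ h : H, h ∉ A ∧ h ∉ B := by
  obtain ⟨a, ha⟩ : ∃ a, a ∉ A := by
    by_contra! h; exact hA (Subgroup.eq_top_iff' _ |>.2 h)
  obtain ⟨b, hb⟩ : ∃ b, b ∉ B := by
    by_contra! h; exact hB (Subgroup.eq_top_iff' _ |>.2 h)
  by_cases h1 : a ∈ B
  · by_cases h2 : b ∈ A
    · exact ⟨a * b, fun h => ha ((Subgroup.mul_mem_cancel_right _ h2).1 h),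
        fun h => hb ((Subgroup.mul_mem_cancel_left _ h1).1 h)⟩
    · exact ⟨b, h2, hb⟩
  · exact ⟨a, ha, h1⟩

theorem ne_top_of_two_le {K : Subgroup H} (hK : 2 ≤ Cardinal.mk (H ⧸ K)) : K ≠ ⊤ := by
  rintro rfl
  have h1 : Cardinal.mk (H ⧸ (⊤ : Subgroup H)) ≤ 1 :=
    Cardinal.le_one_iff_subsingleton.2 QuotientGroup.subsingleton_quotient_top
  exact absurd (hK.trans h1) (by norm_num)

open Classical in
theorem count_base (hA : A ≠ ⊤) (hB : B ≠ ⊤)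
    {α : Type*} [Fintype α] (η : α → HNNExtension H A B φ)
    (hgen : Submonoid.closure (Set.range η) = ⊤) :
    ∃ C ρ : ℝ, 0 < C ∧ 0 < ρ ∧ ρ < 1 ∧ ∀ (c c' : HNNExtension H A B φ) (n : ℕ),
      (((W α n).filter (fun w => tlen φ (c * evalWord η w * c') = 0)).card : ℝ) ≤
        C * ρ ^ n * (Fintype.card α : ℝ) ^ n := by
  obtain ⟨h, hhA, hhB⟩ := exists_not_mem_union hA hB
  let X := HNNExtension H A B φ ⧸ (of : H →* HNNExtension H A B φ).range
  have smk : ∀ a g : HNNExtension H A B φ, a • (QuotientGroup.mk g : X) =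
      QuotientGroup.mk (a * g) := fun _ _ => rfl
  have hpp := count_le_of_pingpong η hgen (X := X) t (of h)
    (fun u => {x | vlen φ ((t : HNNExtension H A B φ) ^ ((-u : ℤˣ) : ℤ) • x) < vlen φ x})
    (QuotientGroup.mk 1)
  specialize hpp ?_ ?_ ?_ ?_
  rotate_left 4
  · obtain ⟨C, ρ, hC, hρ0, hρ1, hcount⟩ := hpp
    refine ⟨C, ρ, hC, hρ0, hρ1, fun c c' n => ?_⟩
    refine le_trans (le_of_eq ?_) (hcount (QuotientGroup.mk c') (QuotientGroup.mk c⁻¹) n)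
    congr 1
    refine congrArg Finset.card (Finset.ext fun w => ?_)
    simp only [Finset.mem_filter]
    refine and_congr_right fun _ => ?_
    have key : (evalWord η w • (QuotientGroup.mk c' : X) = QuotientGroup.mk c⁻¹) ↔
        c * evalWord η w * c' ∈ (of : H →* HNNExtension H A B φ).range := by
      rw [MulAction.Quotient.smul_mk, eq_comm, QuotientGroup.eq]
      simp only [inv_inv, smul_eq_mul, mul_assoc]
    rw [tlen_eq_zero]
    refine Iff.trans ?_ key.symm
    simp [MonoidHom.mem_range, eq_comm]
  · intro u
    simp only [Set.mem_ofPred_eq, vlen_mk, not_lt]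
    rw [← map_one of, tlen_of]; simp
  · intro u v x
    induction x using QuotientGroup.induction_on with
    | H g =>
      simp only [Set.mem_ofPred_eq, smk, vlen_mk, smul_eq_mul]
      intro h1 h2
      have := tlen_unique φ (-u) (-v) 1 g h1 (by simpa using h2)
      simpa using this.1
  · intro u x
    induction x using QuotientGroup.induction_on with
    | H g =>
      simp only [Set.mem_ofPred_eq, smk, vlen_mk, smul_eq_mul, neg_neg,
        not_lt]
      intro h1
      have := tlen_t_mul φ u g
      have e : (t : HNNExtension H A B φ) ^ ((-u : ℤˣ) : ℤ) * (t ^ (u : ℤ) * g) = g := by simp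
      rw [e]
      omega
  · intro u v x
    induction x using QuotientGroup.induction_on with
    | H g =>
      simp only [Set.mem_ofPred_eq, smk, vlen_mk, smul_eq_mul]
      intro h1 h2
      rw [tlen_of_mul] at h2
      have := (tlen_unique φ (-u) (-v) h g h1 h2).2
      rcases Int.units_eq_one_or (-u) with hu | hu
      · rw [hu] at this; exact hhA this
      · rw [hu] at this; exact hhB this

end tree

section final

theorem flatMap_split {α β : Type*} (r : α → List β) (w : List α) (hw : w ≠ []) (L1 L2 : List β)
    (h : w.flatMap r = L1 ++ L2) :
    ∃ w1 a w2 i, w = w1 ++ a :: w2 ∧ i ≤ (r a).length ∧ L1 = w1.flatMap r ++ (r a).take i ∧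
      L2 = (r a).drop i ++ w2.flatMap r := by
  induction w generalizing L1 with
  | nil => exact absurd rfl hw
  | cons a w ih =>
    rw [List.flatMap_cons, List.append_eq_append_iff] at h
    rcases h with ⟨M, h1, h2⟩ | ⟨M, h1, h2⟩
    · by_cases hw0 : w = []
      · subst hw0
        simp only [List.flatMap_nil] at h2
        obtain ⟨rfl, rfl⟩ := List.append_eq_nil_iff.1 h2.symm
        exact ⟨[], a, [], (r a).length, by simp, le_rfl, by simpa using h1, by simp⟩
      · obtain ⟨w1, b, w2, i, rfl, hi, e1, e2⟩ := ih hw0 M h2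
        exact ⟨a :: w1, b, w2, i, by simp, hi, by simp [h1, e1], e2⟩
    · refine ⟨[], a, w, L1.length, by simp, by simp [h1], by simp [h1], by simp [h1, h2]⟩

theorem exists_bound (ρ : ℝ) (h0 : 0 < ρ) (h1 : ρ < 1) :
    ∃ D σ : ℝ, 0 < D ∧ 0 < σ ∧ σ < 1 ∧ ∀ n : ℕ, (n : ℝ) * ρ ^ n ≤ D * σ ^ n := by
  set σ := Real.sqrt ρ with hσ
  have hs0 : 0 < σ := Real.sqrt_pos.2 h0
  have hs1 : σ < 1 := by rw [hσ, Real.sqrt_lt' one_pos]; simpa using h1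
  have hss : ρ = σ * σ := (Real.mul_self_sqrt h0.le).symm
  obtain ⟨D, hD⟩ := (tendsto_self_mul_const_pow_of_lt_one hs0.le hs1).bddAbove_range
  refine ⟨max D 1, σ, by positivity, hs0, hs1, fun n => ?_⟩
  have : (n : ℝ) * σ ^ n ≤ D := hD ⟨n, rfl⟩
  rw [hss, mul_pow, ← mul_assoc]
  gcongr
  exact this.trans (le_max_left _ _)

theorem wordCount_eq {α : Type*} [Fintype α] (L : Set (List α)) [DecidablePred (· ∈ L)] (n : ℕ) :
    wordCount L n = ((W α n).filter (· ∈ L)).card := by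
  unfold wordCount
  refine Nat.subtype_card _ fun w => ?_
  simp [mem_W, and_comm]

theorem main {H : Type*} [Group H] (A B : Subgroup H) (φ : A ≃* B)
    (hA : A ≠ ⊤) (hB : B ≠ ⊤)
    {α : Type*} [Fintype α] (η : α → HNNExtension H A B φ)
    (hgen : Submonoid.closure (Set.range η) = ⊤) :
    StronglyNegligible {w : List α |
        IsElliptic ((HNNExtension.of : H →* HNNExtension H A B φ).range : Set _)
          (evalWord η w)} := by
  classical
  obtain ⟨C, ρ, hC, hρ0, hρ1, hcount⟩ := count_base φ hA hB η hgen
  choose ref hrefL hrefP using exists_letters φ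
  let r : α → List (HNNExtension H A B φ) := fun a => ref (η a)
  have hrp : ∀ w : List α, (w.flatMap r).prod = evalWord η w := by
    intro w
    induction w with
    | nil => simp [evalWord]
    | cons a w ih => simp [ih, evalWord, r, hrefP]
  have hsplit : ∀ w : List α, w ≠ [] →
      IsElliptic ((HNNExtension.of : H →* HNNExtension H A B φ).range : Set _)
          (evalWord η w) →
      ∃ w1 a w2 i, w = w1 ++ a :: w2 ∧ i ≤ (r a).length ∧
        tlen φ (((r a).drop i).prod * evalWord η (w2 ++ w1) * ((r a).take i).prod) = 0 := by
    rintro w hw ⟨_, ⟨h, rfl⟩, hconj⟩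
    obtain ⟨x, hx⟩ := isConj_iff.1 hconj
    obtain ⟨L1, L2, hL, h0⟩ := elliptic_split φ (w.flatMap r) (by
      intro y hy
      obtain ⟨a, _, ha⟩ := List.mem_flatMap.1 hy
      exact hrefL _ _ ha) x (by
        rw [hrp, ← hx]
        have : x⁻¹ * (x * of h * x⁻¹) * x = of h := by group
        rw [this, tlen_of])
    obtain ⟨w1, a, w2, i, e, hi, e1, e2⟩ := flatMap_split r w hw L1 L2 hL
    refine ⟨w1, a, w2, i, e, hi, ?_⟩
    rw [e1, e2, List.prod_append, List.prod_append, hrp, hrp] at h0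
    simpa only [evalWord_append, mul_assoc] using h0
  set N := Fintype.card α with hN
  have hNpos : 0 < N := by
    rw [hN, Fintype.card_pos_iff]
    obtain ⟨w, hw⟩ := exists_word η hgen t
    cases w with
    | nil =>
      exfalso
      have h1 := tlen_t φ 1
      have h2 := tlen_of φ 1
      simp only [evalWord, List.map_nil, List.prod_nil] at hw
      simp [← hw] at h1 h2
      omega
    | cons a w => exact ⟨a⟩
  set Q : ℕ := ∑ a, ((r a).length + 1) with hQ
  have hE : ∀ n : ℕ, ((((W α (n + 1)).filter (· ∈ {w : List α |
        IsElliptic ((HNNExtension.of : H →* HNNExtension H A B φ).range : Set _)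
          (evalWord η w)})).card : ℕ) : ℝ) ≤ (n + 1) * (Q * (C * ρ ^ n * (N : ℝ) ^ n)) := by
    intro n
    let S : α → ℕ → Finset (List α) := fun a i => (W α n).filter (fun w =>
      tlen φ (((r a).drop i).prod * evalWord η w * ((r a).take i).prod) = 0)
    have hsub : (W α (n + 1)).filter (· ∈ {w : List α |
        IsElliptic ((HNNExtension.of : H →* HNNExtension H A B φ).range : Set _)
          (evalWord η w)}) ⊆ (Finset.range (n + 1)).biUnion fun k =>
        Finset.univ.biUnion fun a => (Finset.range ((r a).length + 1)).biUnion fun i =>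
          (S a i).image fun u => u.drop k ++ a :: u.take k := by
      intro w hw
      rw [Finset.mem_filter, mem_W] at hw
      obtain ⟨w1, a, w2, i, rfl, hi, h0⟩ := hsplit w (by rintro rfl; simp at hw) hw.2
      have hlen := hw.1
      simp only [List.length_append, List.length_cons] at hlen
      simp only [Finset.mem_biUnion, Finset.mem_range, Finset.mem_univ, true_and, Finset.mem_image]
      refine ⟨w2.length, by omega, a, i, by omega, w2 ++ w1, ?_, by simp⟩
      simp only [S, Finset.mem_filter, mem_W, List.length_append]
      exact ⟨by omega, h0⟩
    have hcard : (((W α (n + 1)).filter (· ∈ {w : List α |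
        IsElliptic ((HNNExtension.of : H →* HNNExtension H A B φ).range : Set _)
          (evalWord η w)})).card) ≤
        ∑ k ∈ Finset.range (n + 1), ∑ a, ∑ i ∈ Finset.range ((r a).length + 1), (S a i).card := by
      refine (Finset.card_le_card hsub).trans ?_
      refine Finset.card_biUnion_le.trans (Finset.sum_le_sum fun k _ => ?_)
      refine Finset.card_biUnion_le.trans (Finset.sum_le_sum fun a _ => ?_)
      refine Finset.card_biUnion_le.trans (Finset.sum_le_sum fun i _ => ?_)
      exact Finset.card_image_le
    calc _ ≤ ((∑ k ∈ Finset.range (n + 1), ∑ a, ∑ i ∈ Finset.range ((r a).length + 1),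
          (S a i).card : ℕ) : ℝ) := by exact_mod_cast hcard
      _ = ∑ k ∈ Finset.range (n + 1), ∑ a, ∑ i ∈ Finset.range ((r a).length + 1),
          ((S a i).card : ℝ) := by push_cast; rfl
      _ ≤ ∑ k ∈ Finset.range (n + 1), ∑ a, ∑ i ∈ Finset.range ((r a).length + 1),
          (C * ρ ^ n * (N : ℝ) ^ n) := by
        refine Finset.sum_le_sum fun k _ => Finset.sum_le_sum fun a _ =>
          Finset.sum_le_sum fun i _ => hcount _ _ n
      _ = _ := by
        simp only [Finset.sum_const, Finset.card_range, nsmul_eq_mul, ← Finset.sum_mul, hQ]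
        push_cast
        ring
  obtain ⟨D, σ, hD, hσ0, hσ1, hDσ⟩ := exists_bound ρ hρ0 hρ1
  refine ⟨max 1 (D * Q * C * ρ⁻¹), σ, by positivity, hσ0, hσ1, fun n => ?_⟩
  rw [wordCount_eq]
  cases n with
  | zero =>
    refine le_trans ?_ (by simp : (1 : ℝ) ≤ _)
    have : ((W α 0).filter (· ∈ {w : List α |
        IsElliptic ((HNNExtension.of : H →* HNNExtension H A B φ).range : Set _)
          (evalWord η w)})).card ≤ 1 := (Finset.card_filter_le _ _).trans (by simp [W])
    exact_mod_cast this
  | succ n =>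
    have hN1 : (1 : ℝ) ≤ N := by exact_mod_cast hNpos
    calc _ ≤ _ := hE n
      _ = (((n + 1 : ℕ) : ℝ) * ρ ^ (n + 1)) * (Q * C * ρ⁻¹ * (N : ℝ) ^ n) := by
        push_cast
        field_simp
        ring
      _ ≤ (D * σ ^ (n + 1)) * (Q * C * ρ⁻¹ * (N : ℝ) ^ (n + 1)) := by
        have := hDσ (n + 1)
        gcongr
        exact Nat.le_succ n
      _ = (D * Q * C * ρ⁻¹) * σ ^ (n + 1) * (N : ℝ) ^ (n + 1) := by ring
      _ ≤ _ := by
        gcongr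
        exact le_max_right _ _

end final

end HNNNeg

/-- For an HNN extension `G = ⟨H, t | t a t⁻¹ = φ(a), a ∈ A⟩` with
`[H:A] ≥ 2` and `[H:B] ≥ 2`, and any map `η : Σ → G` from a finite set whose image
generates `G` as a monoid, the set of words representing elliptic elements is strongly
negligible; equivalently, the words representing hyperbolic elements are strongly generic. -/
theorem stmt_3 {H : Type*} [Group H] (A B : Subgroup H) (φ : A ≃* B)
    (hA : 2 ≤ Cardinal.mk (H ⧸ A)) (hB : 2 ≤ Cardinal.mk (H ⧸ B))
    {α : Type*} [Fintype α] (η : α → HNNExtension H A B φ)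
    (hgen : Submonoid.closure (Set.range η) = ⊤) :
    StronglyNegligible {w : List α |
        IsElliptic ((HNNExtension.of : H →* HNNExtension H A B φ).range : Set _)
          (evalWord η w)} ∧
    StronglyGeneric {w : List α |
        ¬ IsElliptic ((HNNExtension.of : H →* HNNExtension H A B φ).range : Set _)
          (evalWord η w)} := by
  have key := HNNNeg.main A B φ (HNNNeg.ne_top_of_two_le hA) (HNNNeg.ne_top_of_two_le hB) η hgen
  refine ⟨key, ?_⟩
  unfold StronglyGeneric
  convert key using 1
  ext w
  simp
end
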